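/- arXiv:1109.5662 — 3 statements merged into one kernel-verified Lean document; each statement's English description precedes it below -/
import Mathlib

section
/- For all ξ, η, σ in ℝ³ with ξ ≠ 0, ξ ≠ η, σ ≠ 0, η ≠ σ, and all ε₁, ε₂ ∈ {−1, +1}, setting φ = −‖ξ‖ + ‖ξ − η‖ + ε₁‖σ‖ + ε₂‖η − σ‖, the following vector identity holds: ‖ξ‖ · (−ξ/‖ξ‖ + (ξ − η)/‖ξ − η‖) = ((η − ξ)/‖η − ξ‖) · φ − (ε₁‖σ‖ + ε₂‖η − σ‖) · ((η − ξ)/‖η − ξ‖ + ε₂ (η − σ)/‖η − σ‖) − ε₁‖σ‖ · (ε₁ σ/‖σ‖ − ε₂ (η − σ)/‖η − σ‖). (That is, |ξ| ∇_ξ φ = ((η−ξ)/|η−ξ|) φ − (ε₁|σ| + ε₂|η−σ|) ∇_η φ − ε₁|σ| ∇_σ φ for the cubic phases φ_{+,ε₁,ε₂}.) -/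
/-- The scaling identity |ξ| ∇_ξφ = ((η−ξ)/|η−ξ|) φ − (ε₁|σ| + ε₂|η−σ|) ∇_ηφ − ε₁|σ| ∇_σφ
for the cubic phases φ_{+,ε₁,ε₂}(ξ,η,σ) = −‖ξ‖ + ‖ξ−η‖ + ε₁‖σ‖ + ε₂‖η−σ‖,
valid for ξ ≠ 0, ξ ≠ η, σ ≠ 0, η ≠ σ and ε₁, ε₂ ∈ {−1,+1}. -/
theorem xi_grad_xi_cubic_phase (ξ η σ : EuclideanSpace ℝ (Fin 3))
    (hξ : ξ ≠ 0) (hξη : ξ ≠ η) (hσ : σ ≠ 0) (hησ : η ≠ σ)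
    (ε₁ ε₂ : ℝ) (hε₁ : ε₁ = -1 ∨ ε₁ = 1) (hε₂ : ε₂ = -1 ∨ ε₂ = 1) :
    ‖ξ‖ • (-(‖ξ‖⁻¹ • ξ) + ‖ξ - η‖⁻¹ • (ξ - η))
      = (-‖ξ‖ + ‖ξ - η‖ + ε₁ * ‖σ‖ + ε₂ * ‖η - σ‖) • (‖η - ξ‖⁻¹ • (η - ξ))
        - (ε₁ * ‖σ‖ + ε₂ * ‖η - σ‖) •
            (‖η - ξ‖⁻¹ • (η - ξ) + ε₂ • (‖η - σ‖⁻¹ • (η - σ)))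
        - (ε₁ * ‖σ‖) • (ε₁ • (‖σ‖⁻¹ • σ) - ε₂ • (‖η - σ‖⁻¹ • (η - σ))) := by
  have h₁ : ‖ξ‖ ≠ 0 := norm_ne_zero_iff.mpr hξ
  have h₂ : ‖η - ξ‖ ≠ 0 := norm_ne_zero_iff.mpr (sub_ne_zero.mpr hξη.symm)
  have h₃ : ‖σ‖ ≠ 0 := norm_ne_zero_iff.mpr hσ
  have h₄ : ‖η - σ‖ ≠ 0 := norm_ne_zero_iff.mpr (sub_ne_zero.mpr hησ)
  rw [norm_sub_rev ξ η]
  generalize ‖ξ‖ = a at *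
  generalize ‖η - ξ‖ = b at *
  generalize ‖σ‖ = c at *
  generalize ‖η - σ‖ = d at *
  rcases hε₁ with rfl | rfl <;> rcases hε₂ with rfl | rfl <;>
    match_scalars <;> field_simp <;> ring
end

section
/- There exists a constant C > 0 such that for every Schwartz function f : ℝ³ → ℂ and every t > 0, ‖e^{itΛ} f‖_{L^∞(ℝ³)} ≤ (C/t) · ‖ |x| Λ²f ‖_{L²(ℝ³)}^{1/2} · ‖ |x|² Λ²f ‖_{L²(ℝ³)}^{1/2}, where |x| denotes multiplication by the function x ↦ ‖x‖. -/
open MeasureTheory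
open scoped InnerProductSpace FourierTransform ENNReal

/-- The half-wave propagator e^{itΛ}, defined on the Fourier side by
(e^{itΛ}f)(x) = ∫ e^{2πi⟨x,ξ⟩} e^{2πit‖ξ‖} f̂(ξ) dξ. -/
noncomputable def halfWave (t : ℝ) (f : EuclideanSpace ℝ (Fin 3) → ℂ)
    (x : EuclideanSpace ℝ (Fin 3)) : ℂ :=
  ∫ ξ : EuclideanSpace ℝ (Fin 3),
    Complex.exp (2 * Real.pi * Complex.I * ((⟪x, ξ⟫_ℝ + t * ‖ξ‖ : ℝ) : ℂ)) * 𝓕 f ξ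

/-- The Fourier multiplier Λˢ = (2π|∇|)ˢ: Λˢf is the inverse Fourier transform of
ξ ↦ (2π‖ξ‖)ˢ f̂(ξ). -/
noncomputable def lambdaPow (s : ℝ) (f : EuclideanSpace ℝ (Fin 3) → ℂ)
    (x : EuclideanSpace ℝ (Fin 3)) : ℂ :=
  ∫ ξ : EuclideanSpace ℝ (Fin 3),
    Complex.exp (2 * Real.pi * Complex.I * ((⟪x, ξ⟫_ℝ : ℝ) : ℂ)) *
      (((2 * Real.pi * ‖ξ‖) ^ s : ℝ) : ℂ) * 𝓕 f ξ

local notation "𝔼" => EuclideanSpace ℝ (Fin 3)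

open Set in
theorem lintegral_comp_sqrt_le (H : ℝ → ENNReal) (a b : ℝ) (hb : 0 ≤ b) :
    ∫⁻ u : ℝ, H √((u - a) ^ 2 + b) * ENNReal.ofReal (|u - a| / √((u - a) ^ 2 + b)) ≤
      2 * ∫⁻ s in Ioi 0, H s := by
  have key : ∀ s : Set ℝ, MeasurableSet s → InjOn (fun u : ℝ => √(u ^ 2 + b)) s → 0 ∉ s →
      ∫⁻ u in s, H √(u ^ 2 + b) * ENNReal.ofReal (|u| / √(u ^ 2 + b)) ≤
        ∫⁻ s in Ioi 0, H s := by
    intro s hs hinj h0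
    have hpos : ∀ u ∈ s, 0 < u ^ 2 + b := fun u hu => by
      have : u ≠ 0 := fun h => h0 (h ▸ hu)
      positivity
    have hd : ∀ u ∈ s, HasDerivWithinAt (fun u : ℝ => √(u ^ 2 + b)) (u / √(u ^ 2 + b)) s u := by
      intro u hu
      have h1 : HasDerivAt (fun u : ℝ => u ^ 2 + b) (2 * u) u := by
        simpa using (hasDerivAt_pow 2 u).add_const b
      have h2 := (h1.sqrt (hpos u hu).ne').hasDerivWithinAt (s := s)
      rwa [mul_div_mul_left _ _ (two_ne_zero' ℝ)] at h2
    have h := lintegral_image_eq_lintegral_abs_deriv_mul hs hd hinj H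
    calc _ = ∫⁻ u in s, ENNReal.ofReal |u / √(u ^ 2 + b)| * H √(u ^ 2 + b) := by
          simp_rw [abs_div, abs_of_nonneg (Real.sqrt_nonneg _), mul_comm]
      _ = _ := h.symm
      _ ≤ _ := lintegral_mono_set (by
          rintro _ ⟨u, hu, rfl⟩
          exact Real.sqrt_pos.2 (hpos u hu))
  rw [lintegral_sub_right_eq_self
    (fun u => H √(u ^ 2 + b) * ENNReal.ofReal (|u| / √(u ^ 2 + b))) a]
  have hsq : ∀ u v : ℝ, √(u ^ 2 + b) = √(v ^ 2 + b) → u ^ 2 = v ^ 2 := fun u v h => by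
    have := (Real.sqrt_inj (by positivity) (by positivity)).1 h
    linarith
  have h1 := key (Ioi 0) measurableSet_Ioi (fun u hu v hv h =>
    (sq_eq_sq₀ (le_of_lt hu) (le_of_lt hv)).1 (hsq u v h)) (by simp)
  have h2 := key (Iio 0) measurableSet_Iio (fun u hu v hv h => by
    rcases sq_eq_sq_iff_eq_or_eq_neg.1 (hsq u v h) with h | h
    · exact h
    · simp only [mem_Iio] at hu hv; linarith) (by simp)
  rw [← lintegral_add_compl _ (measurableSet_Ioi (a := (0 : ℝ))), compl_Ioi,
    setLIntegral_congr Iio_ae_eq_Iic.symm, two_mul]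
  exact add_le_add h1 h2

/-- Splitting off the `i`-th coordinate of `ℝ³`. -/
noncomputable def coordSplit (i : Fin 3) : 𝔼 ≃ᵐ ℝ × (Fin 2 → ℝ) :=
  (MeasurableEquiv.toLp 2 (Fin 3 → ℝ)).symm.trans
    (MeasurableEquiv.piFinSuccAbove (fun _ : Fin 3 => ℝ) i)

theorem measurePreserving_coordSplit (i : Fin 3) : MeasurePreserving (coordSplit i) :=
  (EuclideanSpace.volume_preserving_symm_measurableEquiv_toLp (Fin 3)).trans
    (volume_preserving_piFinSuccAbove (fun _ : Fin 3 => ℝ) i)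

theorem coordSplit_symm_self (i : Fin 3) (p : ℝ × (Fin 2 → ℝ)) :
    (coordSplit i).symm p i = p.1 :=
  Fin.insertNth_apply_same (α := fun _ : Fin 3 => ℝ) i p.1 p.2

theorem coordSplit_symm_succAbove (i : Fin 3) (p : ℝ × (Fin 2 → ℝ)) (j : Fin 2) :
    (coordSplit i).symm p (i.succAbove j) = p.2 j :=
  Fin.insertNth_apply_succAbove (α := fun _ : Fin 3 => ℝ) i p.1 p.2 j

theorem norm_coordSplit_symm_sub (i : Fin 3) (p : ℝ × (Fin 2 → ℝ)) (x : 𝔼) :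
    ‖(coordSplit i).symm p - x‖ =
      √((p.1 - x i) ^ 2 + ∑ j, (p.2 j - x (i.succAbove j)) ^ 2) := by
  rw [EuclideanSpace.norm_eq, Fin.sum_univ_succAbove _ i]
  simp only [PiLp.sub_apply, coordSplit_symm_self, coordSplit_symm_succAbove, Real.norm_eq_abs,
    sq_abs]

theorem norm_snd_le_norm_coordSplit_symm (i : Fin 3) (p : ℝ × (Fin 2 → ℝ)) :
    ‖p.2‖ ≤ ‖(coordSplit i).symm p‖ := by
  refine (pi_norm_le_iff_of_nonneg (norm_nonneg _)).2 fun j => ?_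
  rw [← coordSplit_symm_succAbove i p j]
  exact PiLp.norm_apply_le _ _

theorem lintegral_weight_mul_coord_le {H : ℝ → ℝ≥0∞} (hH : Measurable H) (x : 𝔼) (i : Fin 3) :
    ∫⁻ y : 𝔼, ENNReal.ofReal ((1 + ‖y‖) ^ (-4 : ℝ)) *
        (H ‖y - x‖ * ENNReal.ofReal (|y i - x i| / ‖y - x‖)) ≤
      (∫⁻ v : Fin 2 → ℝ, ENNReal.ofReal ((1 + ‖v‖) ^ (-4 : ℝ))) *
        (2 * ∫⁻ s in Set.Ioi 0, H s) := by
  rw [← (measurePreserving_coordSplit i).symm.lintegral_comp_emb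
    (coordSplit i).symm.measurableEmbedding, Measure.volume_eq_prod, lintegral_prod_symm']
  · rw [← lintegral_mul_const _ (by fun_prop)]
    refine lintegral_mono fun v => ?_
    calc _ ≤ ∫⁻ u : ℝ, ENNReal.ofReal ((1 + ‖v‖) ^ (-4 : ℝ)) *
          (H √((u - x i) ^ 2 + ∑ j, (v j - x (i.succAbove j)) ^ 2) *
            ENNReal.ofReal (|u - x i| / √((u - x i) ^ 2 + ∑ j, (v j - x (i.succAbove j)) ^ 2))) := by
          refine lintegral_mono fun u => ?_
          rw [norm_coordSplit_symm_sub, coordSplit_symm_self]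
          refine mul_le_mul_left (ENNReal.ofReal_le_ofReal ?_) _
          exact Real.rpow_le_rpow_of_nonpos (by positivity)
            (by simpa using norm_snd_le_norm_coordSplit_symm i (u, v)) (by norm_num)
      _ ≤ _ := by
          rw [lintegral_const_mul' _ _ ENNReal.ofReal_ne_top]
          gcongr
          exact lintegral_comp_sqrt_le H _ _ (by positivity)
  · have : Measurable fun p => (coordSplit i).symm p := (coordSplit i).symm.measurable
    fun_prop

/-- A radial function of `y - x` integrated against a decaying weight is controlled, uniformly in
`x`, by its one-dimensional integral. -/
theorem lintegral_weight_mul_radial_le {H : ℝ → ℝ≥0∞} (hH : Measurable H) (x : 𝔼) :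
    ∫⁻ y : 𝔼, ENNReal.ofReal ((1 + ‖y‖) ^ (-4 : ℝ)) * H ‖y - x‖ ≤
      6 * (∫⁻ v : Fin 2 → ℝ, ENNReal.ofReal ((1 + ‖v‖) ^ (-4 : ℝ))) *
        ∫⁻ s in Set.Ioi 0, H s := by
  have hae : ∀ᵐ y : 𝔼, y ≠ x := by simp [ae_iff, measure_singleton]
  calc _ ≤ ∫⁻ y : 𝔼, ∑ i : Fin 3, ENNReal.ofReal ((1 + ‖y‖) ^ (-4 : ℝ)) *
        (H ‖y - x‖ * ENNReal.ofReal (|y i - x i| / ‖y - x‖)) := by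
        refine lintegral_mono_ae (hae.mono fun y hy => ?_)
        rw [← Finset.mul_sum, ← Finset.mul_sum]
        refine mul_le_mul_right (le_mul_of_one_le_right' ?_) _
        have h0 : 0 < ‖y - x‖ := norm_pos_iff.2 (sub_ne_zero.2 hy)
        rw [← ENNReal.ofReal_sum_of_nonneg (fun _ _ => by positivity), ← Finset.sum_div,
          ENNReal.one_le_ofReal, one_le_div h0, EuclideanSpace.norm_eq]
        refine Real.sqrt_le_iff.2 ⟨Finset.sum_nonneg fun _ _ => abs_nonneg _, ?_⟩
        simpa using Finset.sum_sq_le_sq_sum_of_nonneg (s := Finset.univ)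
          (f := fun i => |y i - x i|) (fun _ _ => abs_nonneg _)
    _ = ∑ i : Fin 3, ∫⁻ y : 𝔼, ENNReal.ofReal ((1 + ‖y‖) ^ (-4 : ℝ)) *
        (H ‖y - x‖ * ENNReal.ofReal (|y i - x i| / ‖y - x‖)) := by
        refine lintegral_finsetSum _ fun i _ => ?_
        fun_prop
    _ ≤ ∑ i : Fin 3, (∫⁻ v : Fin 2 → ℝ, ENNReal.ofReal ((1 + ‖v‖) ^ (-4 : ℝ))) *
        (2 * ∫⁻ s in Set.Ioi 0, H s) :=
        Finset.sum_le_sum fun i _ => lintegral_weight_mul_coord_le hH x i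
    _ = _ := by
        rw [Finset.sum_const, Finset.card_univ, Fintype.card_fin, nsmul_eq_mul]
        push_cast
        ring

theorem exists_linearIsometryEquiv_single (z : 𝔼) :
    ∃ Q : 𝔼 ≃ₗᵢ[ℝ] 𝔼, Q (EuclideanSpace.single 0 ‖z‖) = z :=
  ⟨(ℝ ∙ (EuclideanSpace.single (0 : Fin 3) ‖z‖ - z))ᗮ.reflection,
    Submodule.reflection_sub (by simp)⟩

theorem integrable_exp_neg_norm_div {σ : ℝ} (hσ : 0 < σ) :
    Integrable fun ξ : 𝔼 => Real.exp (-(2 * Real.pi * σ * ‖ξ‖)) / (2 * Real.pi * ‖ξ‖) := by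
  rw [integrable_fun_norm_addHaar volume
    (f := fun r => Real.exp (-(2 * Real.pi * σ * r)) / (2 * Real.pi * r))]
  have h := (integrableOn_rpow_mul_exp_neg_mul_rpow (s := 1) (p := 1) (b := 2 * Real.pi * σ)
    (by norm_num) one_pos (by positivity)).const_mul (2 * Real.pi)⁻¹
  refine (integrableOn_congr_fun (fun r hr => ?_) measurableSet_Ioi).1 h
  have hr : 0 < r := hr
  simp only [finrank_euclideanSpace, Fintype.card_fin, Real.rpow_one, smul_eq_mul]
  field_simp

/-- The function on the Fourier side whose inverse Fourier transform is the Poisson-type kernel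
`1 / (2 π² (w² + ‖z‖²))`. -/
noncomputable def poissonSymbol (w : ℂ) (r : ℝ) : ℂ :=
  Complex.exp (-(2 * Real.pi * w * r)) / (2 * Real.pi * r)

theorem norm_poissonSymbol (w : ℂ) {r : ℝ} (hr : 0 ≤ r) :
    ‖poissonSymbol w r‖ = Real.exp (-(2 * Real.pi * w.re * r)) / (2 * Real.pi * r) := by
  rw [poissonSymbol, norm_div, Complex.norm_exp]
  congr 1
  · congr 1
    simp
  · simp [abs_of_nonneg hr, abs_of_nonneg Real.pi_nonneg]

theorem measurable_poissonSymbol (w : ℂ) : Measurable (poissonSymbol w) := by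
  unfold poissonSymbol
  fun_prop

theorem integrable_poissonSymbol {w : ℂ} (hw : 0 < w.re) :
    Integrable fun ξ : 𝔼 => poissonSymbol w ‖ξ‖ := by
  refine (integrable_exp_neg_norm_div hw).mono'
    ((measurable_poissonSymbol w).comp measurable_norm).aestronglyMeasurable (ae_of_all _ fun ξ => ?_)
  rw [norm_poissonSymbol w (norm_nonneg _)]

theorem integral_mul_poissonSymbol_sqrt {w : ℂ} (hw : 0 < w.re) {u : ℝ} (hu : u ≠ 0) :
    ∫ ρ in Set.Ioi (0 : ℝ), ρ • poissonSymbol w √(u ^ 2 + ρ ^ 2) =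
      Complex.exp (-(2 * Real.pi * w * |u|)) / (4 * Real.pi ^ 2 * w) := by
  have hw0 : w ≠ 0 := fun h => by simp [h] at hw
  have hpi : (Real.pi : ℂ) ≠ 0 := by exact_mod_cast Real.pi_ne_zero
  have hpos : ∀ ρ : ℝ, 0 < u ^ 2 + ρ ^ 2 := fun ρ => by positivity
  have hd : ∀ ρ ∈ Set.Ici (0 : ℝ), HasDerivAt
      (fun ρ : ℝ => -(Complex.exp (-(2 * Real.pi * w * (√(u ^ 2 + ρ ^ 2) : ℝ))) /
        (4 * Real.pi ^ 2 * w))) (ρ • poissonSymbol w √(u ^ 2 + ρ ^ 2)) ρ := by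
    intro ρ _
    have h1 : HasDerivAt (fun ρ : ℝ => √(u ^ 2 + ρ ^ 2)) (2 * ρ / (2 * √(u ^ 2 + ρ ^ 2))) ρ := by
      have : HasDerivAt (fun ρ : ℝ => u ^ 2 + ρ ^ 2) (2 * ρ) ρ := by
        simpa using (hasDerivAt_pow 2 ρ).const_add (u ^ 2)
      exact this.sqrt (hpos ρ).ne'
    have h2 := ((h1.ofReal_comp.const_mul (2 * Real.pi * w)).neg.cexp.div_const
      (4 * Real.pi ^ 2 * w)).neg
    refine h2.congr_deriv ?_
    have hs : ((√(u ^ 2 + ρ ^ 2) : ℝ) : ℂ) ≠ 0 := by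
      exact_mod_cast (Real.sqrt_pos.2 (hpos ρ)).ne'
    rw [poissonSymbol, Complex.real_smul]
    simp only [Pi.neg_apply]
    push_cast
    field_simp
    ring
  have hInt : IntegrableOn (fun ρ : ℝ => ρ • poissonSymbol w √(u ^ 2 + ρ ^ 2)) (Set.Ioi 0) := by
    have hb := (exp_neg_integrableOn_Ioi 0 (b := 2 * Real.pi * w.re) (by positivity)).mul_const
      (2 * Real.pi)⁻¹
    refine Integrable.mono' hb ?_ ?_
    · exact (measurable_id.smul ((measurable_poissonSymbol w).comp
        (by fun_prop))).aestronglyMeasurable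
    · refine (ae_restrict_iff' measurableSet_Ioi).2 (ae_of_all _ fun ρ hρ => ?_)
      have hρ : 0 < ρ := hρ
      have hle : ρ ≤ √(u ^ 2 + ρ ^ 2) := Real.le_sqrt_of_sq_le (by nlinarith [sq_nonneg u])
      rw [norm_smul, norm_poissonSymbol w (Real.sqrt_nonneg _), Real.norm_of_nonneg hρ.le]
      calc _ = Real.exp (-(2 * Real.pi * w.re * √(u ^ 2 + ρ ^ 2))) * (2 * Real.pi)⁻¹ *
            (ρ / √(u ^ 2 + ρ ^ 2)) := by
            field_simp
        _ ≤ Real.exp (-(2 * Real.pi * w.re * √(u ^ 2 + ρ ^ 2))) * (2 * Real.pi)⁻¹ * 1 := by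
            gcongr
            exact div_le_one_of_le₀ hle (Real.sqrt_nonneg _)
        _ ≤ _ := by
            rw [mul_one]
            gcongr
            rw [neg_mul]
            gcongr
  have hlim : Filter.Tendsto (fun ρ : ℝ => -(Complex.exp
      (-(2 * Real.pi * w * (√(u ^ 2 + ρ ^ 2) : ℝ))) / (4 * Real.pi ^ 2 * w)))
      Filter.atTop (nhds 0) := by
    rw [show (0 : ℂ) = -(0 / (4 * Real.pi ^ 2 * w)) by simp]
    refine (Filter.Tendsto.div_const ?_ _).neg
    rw [Complex.tendsto_exp_nhds_zero_iff]
    have : ∀ ρ : ℝ, (-(2 * Real.pi * w * (√(u ^ 2 + ρ ^ 2) : ℝ))).re =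
        -(2 * Real.pi * w.re * √(u ^ 2 + ρ ^ 2)) := fun ρ => by simp
    simp_rw [this]
    refine Filter.tendsto_neg_atTop_atBot.comp
      (Filter.Tendsto.const_mul_atTop (by positivity) ?_)
    refine Filter.tendsto_atTop_mono (fun ρ => ?_) Filter.tendsto_id
    exact Real.le_sqrt_of_sq_le (by simp only [id]; nlinarith [sq_nonneg u])
  rw [integral_Ioi_of_hasDerivAt_of_tendsto' hd hInt hlim]
  simp [Real.sqrt_sq_eq_abs]

theorem integral_poissonSymbol_plane {w : ℂ} (hw : 0 < w.re) {u : ℝ} (hu : u ≠ 0) :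
    ∫ v : Fin 2 → ℝ, poissonSymbol w √(u ^ 2 + ∑ j, v j ^ 2) =
      Complex.exp (-(2 * Real.pi * w * |u|)) / (2 * Real.pi * w) := by
  have hw0 : w ≠ 0 := fun h => by simp [h] at hw
  have hpi : (Real.pi : ℂ) ≠ 0 := by exact_mod_cast Real.pi_ne_zero
  have h1 : ∫ v : Fin 2 → ℝ, poissonSymbol w √(u ^ 2 + ∑ j, v j ^ 2) =
      ∫ v : EuclideanSpace ℝ (Fin 2), poissonSymbol w √(u ^ 2 + ‖v‖ ^ 2) := by
    rw [← (PiLp.volume_preserving_toLp (Fin 2)).integral_comp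
      (MeasurableEquiv.toLp 2 (Fin 2 → ℝ)).measurableEmbedding]
    simp [EuclideanSpace.norm_sq_eq]
  rw [h1, integral_fun_norm_addHaar volume (fun r => poissonSymbol w √(u ^ 2 + r ^ 2))]
  simp only [finrank_euclideanSpace, Fintype.card_fin, Nat.add_one_sub_one, pow_one]
  rw [integral_mul_poissonSymbol_sqrt hw hu]
  simp [Measure.real, EuclideanSpace.volume_ball_fin_two, ENNReal.toReal_ofReal Real.pi_nonneg]
  field_simp
  ring

theorem integral_exp_mul_I_mul_exp_neg_abs {w : ℂ} (hw : 0 < w.re) (a : ℝ) :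
    ∫ u : ℝ, Complex.exp (2 * Real.pi * Complex.I * (a * u : ℝ)) *
        Complex.exp (-(2 * Real.pi * w * |u|)) =
      w / (Real.pi * (w ^ 2 + a ^ 2)) := by
  have hpi : (Real.pi : ℂ) ≠ 0 := by exact_mod_cast Real.pi_ne_zero
  have hre1 : 0 < (2 * Real.pi * (w + Complex.I * a)).re := by
    simp; positivity
  have hre2 : (2 * Real.pi * (-w + Complex.I * a)).re < 0 := by
    simp; positivity
  have h1 : Set.EqOn (fun u : ℝ => Complex.exp (2 * Real.pi * Complex.I * (a * u : ℝ)) *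
      Complex.exp (-(2 * Real.pi * w * |u|)))
      (fun u : ℝ => Complex.exp (2 * Real.pi * (w + Complex.I * a) * u)) (Set.Iic 0) := by
    intro u hu
    simp only [abs_of_nonpos (Set.mem_Iic.1 hu), ← Complex.exp_add]
    congr 1
    push_cast
    ring
  have h2 : Set.EqOn (fun u : ℝ => Complex.exp (2 * Real.pi * Complex.I * (a * u : ℝ)) *
      Complex.exp (-(2 * Real.pi * w * |u|)))
      (fun u : ℝ => Complex.exp (2 * Real.pi * (-w + Complex.I * a) * u)) (Set.Ioi 0) := by
    intro u hu
    simp only [abs_of_pos (Set.mem_Ioi.1 hu), ← Complex.exp_add]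
    congr 1
    push_cast
    ring
  have hi1 := (integrableOn_congr_fun h1 measurableSet_Iic).2
    (integrableOn_exp_mul_complex_Iic hre1 0)
  have hi2 := (integrableOn_congr_fun h2 measurableSet_Ioi).2
    (integrableOn_exp_mul_complex_Ioi hre2 0)
  rw [← intervalIntegral.integral_Iic_add_Ioi hi1 hi2, setIntegral_congr_fun measurableSet_Iic h1,
    setIntegral_congr_fun measurableSet_Ioi h2, integral_exp_mul_complex_Iic hre1,
    integral_exp_mul_complex_Ioi hre2]
  have hn1 : w + Complex.I * a ≠ 0 := fun h => by simp [h] at hre1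
  have hn2 : -w + Complex.I * a ≠ 0 := fun h => by simp [h] at hre2
  have hn3 : w ^ 2 + (a : ℂ) ^ 2 ≠ 0 := by
    have : w ^ 2 + (a : ℂ) ^ 2 = -((w + Complex.I * a) * (-w + Complex.I * a)) := by
      ring_nf; simp
    rw [this]
    exact neg_ne_zero.2 (mul_ne_zero hn1 hn2)
  simp only [Complex.ofReal_zero, mul_zero, Complex.exp_zero]
  field_simp
  ring_nf
  simp

theorem integral_exp_inner_mul_poissonSymbol {w : ℂ} (hw : 0 < w.re) (z : 𝔼) :
    ∫ ξ : 𝔼, Complex.exp (2 * Real.pi * Complex.I * (⟪z, ξ⟫_ℝ : ℝ)) * poissonSymbol w ‖ξ‖ =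
      1 / (2 * Real.pi ^ 2 * (w ^ 2 + ‖z‖ ^ 2)) := by
  have hw0 : w ≠ 0 := fun h => by simp [h] at hw
  have hpi : (Real.pi : ℂ) ≠ 0 := by exact_mod_cast Real.pi_ne_zero
  obtain ⟨Q, hQ⟩ := exists_linearIsometryEquiv_single z
  have hInt : Integrable fun ξ : 𝔼 =>
      Complex.exp (2 * Real.pi * Complex.I * (‖z‖ * ξ 0 : ℝ)) * poissonSymbol w ‖ξ‖ := by
    refine (integrable_poissonSymbol hw).bdd_mul (c := 1) ?_ (ae_of_all _ fun ξ => ?_)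
    · exact Continuous.aestronglyMeasurable (by fun_prop)
    · rw [Complex.norm_exp]
      simp
  have hrot : ∫ ξ : 𝔼, Complex.exp (2 * Real.pi * Complex.I * (⟪z, ξ⟫_ℝ : ℝ)) *
        poissonSymbol w ‖ξ‖ =
      ∫ ξ : 𝔼, Complex.exp (2 * Real.pi * Complex.I * (‖z‖ * ξ 0 : ℝ)) * poissonSymbol w ‖ξ‖ := by
    rw [← Q.measurePreserving.integral_comp Q.toMeasurableEquiv.measurableEmbedding]
    refine integral_congr_ae (ae_of_all _ fun ξ => ?_)
    have : ⟪z, Q ξ⟫_ℝ = ‖z‖ * ξ 0 := by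
      conv_lhs => rw [← hQ, Q.inner_map_map]
      simp [EuclideanSpace.inner_single_left]
    simp only [this, Q.norm_map]
  have hmp := (measurePreserving_coordSplit 0).symm
  have hemb := (coordSplit 0).symm.measurableEmbedding
  have hnorm : ∀ p : ℝ × (Fin 2 → ℝ), ‖(coordSplit 0).symm p‖ =
      √(p.1 ^ 2 + ∑ j, p.2 j ^ 2) := fun p => by
    simpa using norm_coordSplit_symm_sub 0 p 0
  rw [← hmp.integrable_comp_emb hemb] at hInt
  rw [hrot, ← hmp.integral_comp hemb]
  simp only [Function.comp_def, coordSplit_symm_self, hnorm] at hInt ⊢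
  rw [Measure.volume_eq_prod] at hInt ⊢
  rw [integral_prod _ hInt]
  have hae : ∀ᵐ u : ℝ, u ≠ 0 := by simp [ae_iff, measure_singleton]
  rw [integral_congr_ae (hae.mono fun u hu => by
    simp only
    rw [integral_const_mul, integral_poissonSymbol_plane hw hu, ← mul_div_assoc]),
    integral_div, integral_exp_mul_I_mul_exp_neg_abs hw]
  field_simp

theorem norm_sq_add_sq_eq (σ t s : ℝ) :
    ‖((σ : ℂ) - t * Complex.I) ^ 2 + (s : ℂ) ^ 2‖ =
      √(σ ^ 2 + (s - t) ^ 2) * √(σ ^ 2 + (s + t) ^ 2) := by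
  have : ((σ : ℂ) - t * Complex.I) ^ 2 + (s : ℂ) ^ 2 =
      (σ + (s - t : ℝ) * Complex.I) * (σ + (-(s + t) : ℝ) * Complex.I) := by
    push_cast
    ring_nf
    simp
  rw [this, norm_mul, Complex.norm_add_mul_I, Complex.norm_add_mul_I, neg_sq]

theorem mul_rpow_le_norm_sq_add_sq {σ t s θ : ℝ} (hσ : 0 < σ) (ht : 0 < t) (hs : 0 ≤ s)
    (hθ : 0 ≤ θ) (hθ' : θ ≤ 1) :
    t * (σ ^ (1 - θ) * |s - t| ^ θ) ≤ ‖((σ : ℂ) - t * Complex.I) ^ 2 + (s : ℂ) ^ 2‖ := by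
  rw [norm_sq_add_sq_eq, mul_comm]
  set m := √(σ ^ 2 + (s - t) ^ 2)
  have h1 : σ ≤ m := Real.le_sqrt_of_sq_le (by nlinarith [sq_nonneg (s - t)])
  have h2 : |s - t| ≤ m := Real.abs_le_sqrt (by nlinarith [sq_nonneg σ])
  have hm : 0 < m := hσ.trans_le h1
  refine mul_le_mul ?_ (Real.le_sqrt_of_sq_le (by nlinarith [sq_nonneg σ])) ht.le hm.le
  calc σ ^ (1 - θ) * |s - t| ^ θ ≤ m ^ (1 - θ) * m ^ θ := by
        gcongr
    _ = m := by rw [← Real.rpow_add hm]; simp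

theorem mul_le_norm_sq_add_sq {σ t s r : ℝ} (hσ : 0 < σ) (ht : 0 < t) (hs : 0 ≤ s)
    (hr : r = t ∨ r = s) :
    σ * r ≤ ‖((σ : ℂ) - t * Complex.I) ^ 2 + (s : ℂ) ^ 2‖ := by
  rw [norm_sq_add_sq_eq]
  have hr0 : 0 ≤ r := by rcases hr with rfl | rfl <;> linarith
  refine mul_le_mul (Real.le_sqrt_of_sq_le (by nlinarith [sq_nonneg (s - t)]))
    (Real.le_sqrt_of_sq_le ?_) hr0 (Real.sqrt_nonneg _)
  rcases hr with rfl | rfl <;> nlinarith [sq_nonneg σ]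

theorem norm_inv_sub_inv_le {σ t s s' d θ : ℝ} (hσ : 0 < σ) (ht : 0 < t) (hs : 0 ≤ s)
    (hs' : 0 ≤ s') (hd : |s - s'| ≤ d) (hd0 : 0 < d) (hθ : 0 ≤ θ) (hθ' : θ ≤ 1) :
    ‖(((σ : ℂ) - t * Complex.I) ^ 2 + (s : ℂ) ^ 2)⁻¹ -
        (((σ : ℂ) - t * Complex.I) ^ 2 + (s' : ℂ) ^ 2)⁻¹‖ ≤
      2 / t * (σ ^ (-1 - θ) * d ^ θ) := by
  set P := ((σ : ℂ) - t * Complex.I) ^ 2 + (s : ℂ) ^ 2 with hP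
  set P' := ((σ : ℂ) - t * Complex.I) ^ 2 + (s' : ℂ) ^ 2 with hP'
  have h1 : σ * t ≤ ‖P‖ := mul_le_norm_sq_add_sq hσ ht hs (Or.inl rfl)
  have h2 : σ * s ≤ ‖P‖ := mul_le_norm_sq_add_sq hσ ht hs (Or.inr rfl)
  have h1' : σ * t ≤ ‖P'‖ := mul_le_norm_sq_add_sq hσ ht hs' (Or.inl rfl)
  have h2' : σ * s' ≤ ‖P'‖ := mul_le_norm_sq_add_sq hσ ht hs' (Or.inr rfl)
  have hst : 0 < σ * t := by positivity
  have hp : 0 < ‖P‖ := hst.trans_le h1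
  have hp' : 0 < ‖P'‖ := hst.trans_le h1'
  have hA : ‖P⁻¹ - P'⁻¹‖ ≤ 2 / (σ * t) := by
    calc _ ≤ ‖P⁻¹‖ + ‖P'⁻¹‖ := norm_sub_le _ _
      _ ≤ (σ * t)⁻¹ + (σ * t)⁻¹ := by
          rw [norm_inv, norm_inv]
          gcongr
      _ = _ := by ring
  have hB : ‖P⁻¹ - P'⁻¹‖ ≤ 2 / (σ * t) * (d / σ) := by
    rw [inv_sub_inv (norm_pos_iff.1 hp) (norm_pos_iff.1 hp')]
    have : P' - P = ((s' - s) * (s' + s) : ℝ) := by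
      rw [hP, hP']
      push_cast
      ring
    rw [this, norm_div, norm_mul, Complex.norm_real, norm_mul, Real.norm_eq_abs, Real.norm_eq_abs,
      abs_sub_comm, abs_of_nonneg (add_nonneg hs' hs), div_le_iff₀ (by positivity)]
    have h3 : (s' + s) * (σ * (σ * t)) ≤ 2 * (‖P‖ * ‖P'‖) := by
      nlinarith [mul_le_mul h2 h1' hst.le hp.le, mul_le_mul h1 h2' (by positivity) hp.le]
    calc |s - s'| * (s' + s) ≤ d * (s' + s) := by gcongr
      _ = d * ((s' + s) * (σ * (σ * t))) / (σ * (σ * t)) := by field_simp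
      _ ≤ d * (2 * (‖P‖ * ‖P'‖)) / (σ * (σ * t)) := by gcongr
      _ = _ := by field_simp
  have hmin : ‖P⁻¹ - P'⁻¹‖ ≤ 2 / (σ * t) * (d / σ) ^ θ := by
    rcases le_total (d / σ) 1 with h | h
    · refine hB.trans ?_
      gcongr
      simpa using Real.rpow_le_rpow_of_exponent_ge (by positivity) h hθ'
    · refine hA.trans (le_mul_of_one_le_right (by positivity) (Real.one_le_rpow h hθ))
  refine hmin.trans_eq ?_
  rw [Real.div_rpow hd0.le hσ.le, Real.rpow_sub hσ, Real.rpow_neg_one]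
  field_simp

/-- `Λ²f` as a Schwartz function, together with its Fourier transform. -/
theorem exists_schwartz_lambdaPow_two (f : SchwartzMap 𝔼 ℂ) :
    ∃ g : SchwartzMap 𝔼 ℂ, lambdaPow 2 f = g ∧
      ∀ ξ, 𝓕 (g : 𝔼 → ℂ) ξ = ((2 * Real.pi * ‖ξ‖) ^ 2 : ℝ) * 𝓕 (f : 𝔼 → ℂ) ξ := by
  have htemp : Function.HasTemperateGrowth fun ξ : 𝔼 => (((2 * Real.pi) ^ 2 * ‖ξ‖ ^ 2 : ℝ) : ℂ) := by
    fun_prop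
  set G := SchwartzMap.smulLeftCLM ℂ (fun ξ : 𝔼 => (((2 * Real.pi) ^ 2 * ‖ξ‖ ^ 2 : ℝ) : ℂ)) (𝓕 f)
    with hG
  have hGa : ∀ ξ, G ξ = ((2 * Real.pi * ‖ξ‖) ^ 2 : ℝ) * 𝓕 (f : 𝔼 → ℂ) ξ := fun ξ => by
    rw [hG, SchwartzMap.smulLeftCLM_apply htemp, SchwartzMap.fourier_coe]
    simp only [smul_eq_mul, mul_pow]
  refine ⟨𝓕⁻ G, ?_, fun ξ => ?_⟩
  · ext x
    rw [SchwartzMap.fourierInv_coe, Real.fourierInv_eq', lambdaPow]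
    refine integral_congr_ae (ae_of_all _ fun ξ => ?_)
    simp only [hGa, smul_eq_mul, Real.rpow_two, real_inner_comm]
    rw [mul_assoc]
    congr 2
    push_cast
    ring
  · rw [← SchwartzMap.fourier_coe, FourierTransform.fourier_fourierInv_eq, hGa]

theorem integral_mul_exp_neg_mul_Ioi {a : ℝ} (ha : 0 < a) :
    ∫ σ in Set.Ioi (0 : ℝ), a * Real.exp (-(a * σ)) = 1 := by
  rw [integral_const_mul]
  have := integral_exp_mul_Ioi (neg_lt_zero.2 ha) 0
  simp only [neg_mul] at this
  rw [this]
  simp [ha.ne']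

/-- The damped frequency-side integrand whose integral over `σ > 0` is that of `halfWave`. -/
noncomputable def dampedIntegrand (t : ℝ) (f : 𝔼 → ℂ) (x ξ : 𝔼) (σ : ℝ) : ℂ :=
  (Complex.exp (2 * Real.pi * Complex.I * ((⟪x, ξ⟫_ℝ + t * ‖ξ‖ : ℝ) : ℂ)) * 𝓕 f ξ) *
    (2 * Real.pi * ‖ξ‖ * Real.exp (-(2 * Real.pi * ‖ξ‖ * σ)) : ℝ)

theorem integral_dampedIntegrand (t : ℝ) (f : 𝔼 → ℂ) (x : 𝔼) {ξ : 𝔼} (hξ : ξ ≠ 0) :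
    ∫ σ in Set.Ioi (0 : ℝ), dampedIntegrand t f x ξ σ =
      Complex.exp (2 * Real.pi * Complex.I * ((⟪x, ξ⟫_ℝ + t * ‖ξ‖ : ℝ) : ℂ)) * 𝓕 f ξ := by
  simp only [dampedIntegrand]
  have h0 : 0 < ‖ξ‖ := norm_pos_iff.2 hξ
  rw [integral_const_mul, integral_complex_ofReal, integral_mul_exp_neg_mul_Ioi (by positivity)]
  simp

theorem integrable_dampedIntegrand (t : ℝ) (f : SchwartzMap 𝔼 ℂ) (x : 𝔼) :
    Integrable (Function.uncurry (dampedIntegrand t f x))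
      (volume.prod (volume.restrict (Set.Ioi (0 : ℝ)))) := by
  have hcont : Continuous (𝓕 (f : 𝔼 → ℂ)) := (𝓕 f : SchwartzMap 𝔼 ℂ).continuous
  have hae : ∀ᵐ ξ : 𝔼, ξ ≠ 0 := by simp [ae_iff, measure_singleton]
  refine (integrable_prod_iff ?_).2 ⟨hae.mono fun ξ hξ => ?_, ?_⟩
  · refine Continuous.aestronglyMeasurable ?_
    unfold dampedIntegrand Function.uncurry
    fun_prop
  · have h0 : 0 < ‖ξ‖ := norm_pos_iff.2 hξ
    have h := exp_neg_integrableOn_Ioi 0 (b := 2 * Real.pi * ‖ξ‖) (by positivity)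
    simp only [neg_mul] at h
    exact ((h.const_mul (2 * Real.pi * ‖ξ‖)).ofReal (𝕜 := ℂ)).const_mul
      (Complex.exp (2 * Real.pi * Complex.I * ((⟪x, ξ⟫_ℝ + t * ‖ξ‖ : ℝ) : ℂ)) * 𝓕 (f : 𝔼 → ℂ) ξ)
  · have hF : Integrable (𝓕 (f : 𝔼 → ℂ)) := (𝓕 f : SchwartzMap 𝔼 ℂ).integrable
    refine hF.norm.congr (hae.mono fun ξ hξ => ?_)
    have h0 : 0 < ‖ξ‖ := norm_pos_iff.2 hξ
    have : ∀ σ : ℝ, ‖Function.uncurry (dampedIntegrand t f x) (ξ, σ)‖ =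
        ‖𝓕 (f : 𝔼 → ℂ) ξ‖ * (2 * Real.pi * ‖ξ‖ * Real.exp (-(2 * Real.pi * ‖ξ‖ * σ))) := by
      intro σ
      simp only [Function.uncurry, dampedIntegrand]
      rw [norm_mul, norm_mul, Complex.norm_exp, Complex.norm_real, Real.norm_of_nonneg
        (by positivity)]
      simp
    simp only [this]
    rw [integral_const_mul, integral_mul_exp_neg_mul_Ioi (by positivity), mul_one]

theorem halfWave_eq_integral (t : ℝ) (f : SchwartzMap 𝔼 ℂ) (x : 𝔼) :
    halfWave t f x = ∫ σ in Set.Ioi (0 : ℝ), ∫ ξ : 𝔼, dampedIntegrand t f x ξ σ := by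
  have hae : ∀ᵐ ξ : 𝔼, ξ ≠ 0 := by simp [ae_iff, measure_singleton]
  rw [← integral_integral_swap (integrable_dampedIntegrand t f x), halfWave]
  exact integral_congr_ae (hae.mono fun ξ hξ => (integral_dampedIntegrand t f x hξ).symm)

theorem integral_dampedIntegrand_eq_convolution {f g : SchwartzMap 𝔼 ℂ}
    (hg : ∀ ξ, 𝓕 (g : 𝔼 → ℂ) ξ = ((2 * Real.pi * ‖ξ‖) ^ 2 : ℝ) * 𝓕 (f : 𝔼 → ℂ) ξ)
    (t : ℝ) (x : 𝔼) {σ : ℝ} (hσ : 0 < σ) :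
    ∫ ξ : 𝔼, dampedIntegrand t f x ξ σ =
      ∫ y : 𝔼, g y * (1 / (2 * Real.pi ^ 2) *
        (((σ : ℂ) - t * Complex.I) ^ 2 + (‖y - x‖ : ℂ) ^ 2)⁻¹) := by
  set w : ℂ := (σ : ℂ) - t * Complex.I with hw
  have hwre : 0 < w.re := by simpa [hw] using hσ
  set m : 𝔼 → ℂ := fun ξ =>
    Complex.exp (2 * Real.pi * Complex.I * (⟪x, ξ⟫_ℝ : ℝ)) * poissonSymbol w ‖ξ‖ with hm
  have hmint : Integrable m := by
    refine (integrable_poissonSymbol hwre).bdd_mul (c := 1) ?_ (ae_of_all _ fun ξ => ?_)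
    · exact Continuous.aestronglyMeasurable (by fun_prop)
    · rw [Complex.norm_exp]
      simp
  have hFm : ∀ y, 𝓕 m y = 1 / (2 * Real.pi ^ 2) * (w ^ 2 + (‖y - x‖ : ℂ) ^ 2)⁻¹ := by
    intro y
    rw [Real.fourier_eq', norm_sub_rev, one_div, ← mul_inv, ← one_div,
      ← integral_exp_inner_mul_poissonSymbol hwre]
    refine integral_congr_ae (ae_of_all _ fun ξ => ?_)
    simp only [hm, smul_eq_mul]
    rw [← mul_assoc, ← Complex.exp_add, inner_sub_left, real_inner_comm y ξ]
    congr 2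
    push_cast
    ring
  have hflip := VectorFourier.integral_fourierIntegral_smul_eq_flip (L := innerₗ 𝔼)
    (μ := volume) (ν := volume) Real.continuous_fourierChar
    (continuous_inner (𝕜 := ℝ) (E := 𝔼)) g.integrable hmint
  calc _ = ∫ ξ : 𝔼, 𝓕 (g : 𝔼 → ℂ) ξ • m ξ := by
        refine integral_congr_ae (ae_of_all _ fun ξ => ?_)
        simp only [hg, hm, dampedIntegrand, poissonSymbol, smul_eq_mul]
        rcases eq_or_ne ξ 0 with rfl | hξ
        · simp
        have h0 : (‖ξ‖ : ℂ) ≠ 0 := by exact_mod_cast norm_ne_zero_iff.2 hξ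
        have hpi : (Real.pi : ℂ) ≠ 0 := by exact_mod_cast Real.pi_ne_zero
        have hexp : Complex.exp (2 * Real.pi * Complex.I * ((⟪x, ξ⟫_ℝ + t * ‖ξ‖ : ℝ) : ℂ)) *
            Complex.exp (-(2 * Real.pi * ‖ξ‖ * σ)) =
            Complex.exp (2 * Real.pi * Complex.I * (⟪x, ξ⟫_ℝ : ℝ)) *
              Complex.exp (-(2 * Real.pi * w * ‖ξ‖)) := by
          rw [← Complex.exp_add, ← Complex.exp_add, hw]
          congr 1
          push_cast
          ring
        push_cast at hexp ⊢
        generalize Complex.exp (2 * Real.pi * Complex.I * (⟪x, ξ⟫_ℝ + t * ‖ξ‖)) = e₁ at hexp ⊢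
        generalize Complex.exp (-(2 * Real.pi * ‖ξ‖ * σ)) = e₂ at hexp ⊢
        generalize Complex.exp (2 * Real.pi * Complex.I * ⟪x, ξ⟫_ℝ) = e₃ at hexp ⊢
        generalize Complex.exp (-(2 * Real.pi * w * ‖ξ‖)) = e₄ at hexp ⊢
        field_simp
        linear_combination 𝓕 (f : 𝔼 → ℂ) ξ * hexp
    _ = ∫ y : 𝔼, g y • 𝓕 m y := by
        simpa [flip_innerₗ] using! hflip
    _ = _ := by simp only [hFm, smul_eq_mul]

theorem integral_eq_zero_of_fourier {f g : SchwartzMap 𝔼 ℂ}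
    (hg : ∀ ξ, 𝓕 (g : 𝔼 → ℂ) ξ = ((2 * Real.pi * ‖ξ‖) ^ 2 : ℝ) * 𝓕 (f : 𝔼 → ℂ) ξ) :
    ∫ y, g y = 0 := by
  have := hg 0
  rw [Real.fourier_eq'] at this
  simpa using this

theorem norm_one_div_two_mul_pi_sq_le : ‖(1 / (2 * Real.pi ^ 2) : ℂ)‖ ≤ 1 := by
  rw [show (1 / (2 * Real.pi ^ 2) : ℂ) = ((1 / (2 * Real.pi ^ 2) : ℝ) : ℂ) by push_cast; rfl,
    Complex.norm_real, Real.norm_of_nonneg (by positivity), div_le_one (by positivity)]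
  nlinarith [Real.pi_gt_three]

theorem enorm_convolution_near_le (g : SchwartzMap 𝔼 ℂ) (x : 𝔼) {t σ θ : ℝ} (ht : 0 < t)
    (hσ : 0 < σ) (hθ : 0 ≤ θ) (hθ' : θ ≤ 1) :
    ‖∫ y : 𝔼, g y * (1 / (2 * Real.pi ^ 2) *
        (((σ : ℂ) - t * Complex.I) ^ 2 + (‖y - x‖ : ℂ) ^ 2)⁻¹)‖ₑ ≤
      ENNReal.ofReal (t⁻¹ * σ ^ (θ - 1)) *
        ∫⁻ y : 𝔼, ‖g y‖ₑ * ENNReal.ofReal (|‖y - x‖ - t| ^ (-θ)) := by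
  have hae : ∀ᵐ y : 𝔼, ‖y - x‖ ≠ t := by
    have := Measure.addHaar_sphere (volume : Measure 𝔼) x t
    simpa [ae_iff, Metric.sphere, dist_eq_norm] using this
  refine (enorm_integral_le_lintegral_enorm _).trans ?_
  rw [← lintegral_const_mul' _ _ ENNReal.ofReal_ne_top]
  refine lintegral_mono_ae (hae.mono fun y hy => ?_)
  have hd : 0 < |‖y - x‖ - t| := abs_pos.2 (sub_ne_zero.2 hy)
  have hD := mul_rpow_le_norm_sq_add_sq hσ ht (norm_nonneg (y - x)) hθ hθ'
  rw [enorm_mul, mul_left_comm, ← ENNReal.ofReal_mul (by positivity)]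
  gcongr
  rw [← ofReal_norm]
  refine ENNReal.ofReal_le_ofReal ?_
  rw [norm_mul, norm_inv]
  calc _ ≤ 1 * (t * (σ ^ (1 - θ) * |‖y - x‖ - t| ^ θ))⁻¹ := by
        gcongr
        exact norm_one_div_two_mul_pi_sq_le
    _ = _ := by
        rw [Real.rpow_neg hd.le, ← neg_sub 1 θ, Real.rpow_neg hσ.le, one_mul, mul_inv, mul_inv,
          mul_assoc]

theorem enorm_convolution_far_le {g : SchwartzMap 𝔼 ℂ} (hg : ∫ y, g y = 0) (x : 𝔼)
    {t σ θ : ℝ} (ht : 0 < t) (hσ : 0 < σ) (hθ : 0 ≤ θ) (hθ' : θ ≤ 1) :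
    ‖∫ y : 𝔼, g y * (1 / (2 * Real.pi ^ 2) *
        (((σ : ℂ) - t * Complex.I) ^ 2 + (‖y - x‖ : ℂ) ^ 2)⁻¹)‖ₑ ≤
      ENNReal.ofReal (2 / t * σ ^ (-1 - θ)) *
        ∫⁻ y : 𝔼, ‖g y‖ₑ * ENNReal.ofReal (‖y‖ ^ θ) := by
  have hae : ∀ᵐ y : 𝔼, y ≠ 0 := by simp [ae_iff, measure_singleton]
  set D : 𝔼 → ℂ := fun y => ((σ : ℂ) - t * Complex.I) ^ 2 + (‖y - x‖ : ℂ) ^ 2 with hD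
  have hInt : Integrable fun y => g y * (1 / (2 * Real.pi ^ 2) * (D y)⁻¹) := by
    refine g.integrable.mul_bdd (c := 1 * (σ * t)⁻¹) ?_ (ae_of_all _ fun y => ?_)
    · refine Measurable.aestronglyMeasurable ?_
      fun_prop
    · rw [norm_mul, norm_inv]
      gcongr
      · exact norm_one_div_two_mul_pi_sq_le
      · exact mul_le_norm_sq_add_sq hσ ht (norm_nonneg _) (Or.inl rfl)
  have hzero : ∫ y, g y * (1 / (2 * Real.pi ^ 2) * (D 0)⁻¹) = 0 := by
    rw [integral_mul_const, hg, zero_mul]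
  have heq : ∫ y, g y * (1 / (2 * Real.pi ^ 2) * (D y)⁻¹) =
      ∫ y, g y * (1 / (2 * Real.pi ^ 2) * ((D y)⁻¹ - (D 0)⁻¹)) := by
    rw [← sub_zero (∫ y, g y * (1 / (2 * Real.pi ^ 2) * (D y)⁻¹)), ← hzero,
      ← integral_sub hInt (g.integrable.mul_const _)]
    simp only [mul_sub]
  rw [heq]
  refine (enorm_integral_le_lintegral_enorm _).trans ?_
  rw [← lintegral_const_mul' _ _ ENNReal.ofReal_ne_top]
  refine lintegral_mono_ae (hae.mono fun y hy => ?_)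
  have hd : |‖y - x‖ - ‖(0 : 𝔼) - x‖| ≤ ‖y‖ := by
    simpa using abs_norm_sub_norm_le (y - x) (0 - x)
  have hle := norm_inv_sub_inv_le hσ ht (norm_nonneg _) (norm_nonneg _) hd (norm_pos_iff.2 hy)
    hθ hθ'
  rw [enorm_mul, mul_left_comm, ← ENNReal.ofReal_mul (by positivity)]
  gcongr
  rw [← ofReal_norm]
  refine ENNReal.ofReal_le_ofReal ?_
  rw [norm_mul]
  calc _ ≤ 1 * (2 / t * (σ ^ (-1 - θ) * ‖y‖ ^ θ)) := by
        gcongr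
        exact norm_one_div_two_mul_pi_sq_le
    _ = _ := by ring

theorem lintegral_rpow_Ioc {R θ : ℝ} (hR : 0 < R) (hθ : 0 < θ) :
    ∫⁻ σ in Set.Ioc 0 R, ENNReal.ofReal (σ ^ (θ - 1)) = ENNReal.ofReal (R ^ θ / θ) := by
  have hi := intervalIntegral.intervalIntegrable_rpow' (a := 0) (b := R) (r := θ - 1) (by linarith)
  rw [intervalIntegrable_iff_integrableOn_Ioc_of_le hR.le] at hi
  rw [← ofReal_integral_eq_lintegral_ofReal hi, ← intervalIntegral.integral_of_le hR.le,
    integral_rpow (Or.inl (by linarith))]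
  · simp [Real.zero_rpow hθ.ne']
  · exact (ae_restrict_iff' measurableSet_Ioc).2 (ae_of_all _ fun σ hσ =>
      Real.rpow_nonneg hσ.1.le _)

theorem lintegral_rpow_Ioi {R θ : ℝ} (hR : 0 < R) (hθ : 0 < θ) :
    ∫⁻ σ in Set.Ioi R, ENNReal.ofReal (σ ^ (-1 - θ)) = ENNReal.ofReal (R ^ (-θ) / θ) := by
  have hlt : -1 - θ < -1 := by linarith
  rw [← ofReal_integral_eq_lintegral_ofReal (integrableOn_Ioi_rpow_of_lt hlt hR),
    integral_Ioi_rpow_of_lt hlt hR]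
  · congr 1
    rw [show -1 - θ + 1 = -θ by ring, neg_div_neg_eq]
  · exact (ae_restrict_iff' measurableSet_Ioi).2 (ae_of_all _ fun σ hσ =>
      Real.rpow_nonneg (hR.le.trans (le_of_lt hσ)) _)

theorem enorm_halfWave_le_lintegral {f g : SchwartzMap 𝔼 ℂ}
    (hg : ∀ ξ, 𝓕 (g : 𝔼 → ℂ) ξ = ((2 * Real.pi * ‖ξ‖) ^ 2 : ℝ) * 𝓕 (f : 𝔼 → ℂ) ξ)
    (x : 𝔼) {t R θ : ℝ} (ht : 0 < t) (hR : 0 < R) (hθ : 0 < θ) (hθ' : θ ≤ 1) :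
    ‖halfWave t f x‖ₑ ≤ ENNReal.ofReal (2 / (t * θ)) *
      ∫⁻ y : 𝔼, ‖g y‖ₑ *
        ENNReal.ofReal (R ^ θ * |‖y - x‖ - t| ^ (-θ) + R ^ (-θ) * ‖y‖ ^ θ) := by
  set Q₁ := ∫⁻ y : 𝔼, ‖g y‖ₑ * ENNReal.ofReal (|‖y - x‖ - t| ^ (-θ)) with hQ₁
  set Q₂ := ∫⁻ y : 𝔼, ‖g y‖ₑ * ENNReal.ofReal (‖y‖ ^ θ) with hQ₂
  have hsplit : Set.Ioi (0 : ℝ) = Set.Ioc 0 R ∪ Set.Ioi R := (Set.Ioc_union_Ioi_eq_Ioi hR.le).symm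
  have hnear : ∫⁻ σ in Set.Ioc 0 R, ‖∫ ξ : 𝔼, dampedIntegrand t f x ξ σ‖ₑ ≤
      ENNReal.ofReal (2 / (t * θ)) * (ENNReal.ofReal (R ^ θ) * Q₁) := by
    calc _ ≤ ∫⁻ σ in Set.Ioc 0 R, ENNReal.ofReal (σ ^ (θ - 1)) * (ENNReal.ofReal t⁻¹ * Q₁) := by
          refine setLIntegral_mono' measurableSet_Ioc fun σ hσ => ?_
          rw [integral_dampedIntegrand_eq_convolution hg t x hσ.1]
          refine (enorm_convolution_near_le g x ht hσ.1 hθ.le hθ').trans_eq ?_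
          rw [ENNReal.ofReal_mul (by positivity)]
          ring
      _ = ENNReal.ofReal (1 / (t * θ)) * (ENNReal.ofReal (R ^ θ) * Q₁) := by
          rw [lintegral_mul_const _ (by fun_prop), lintegral_rpow_Ioc hR hθ, ← mul_assoc,
            ← mul_assoc, ← ENNReal.ofReal_mul (by positivity), ← ENNReal.ofReal_mul (by positivity)]
          congr 2
          field_simp
      _ ≤ _ := by
          gcongr
          norm_num
  have hfar : ∫⁻ σ in Set.Ioi R, ‖∫ ξ : 𝔼, dampedIntegrand t f x ξ σ‖ₑ ≤
      ENNReal.ofReal (2 / (t * θ)) * (ENNReal.ofReal (R ^ (-θ)) * Q₂) := by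
    calc _ ≤ ∫⁻ σ in Set.Ioi R, ENNReal.ofReal (σ ^ (-1 - θ)) * (ENNReal.ofReal (2 / t) * Q₂) := by
          refine setLIntegral_mono' measurableSet_Ioi fun σ hσ => ?_
          have hσ0 : 0 < σ := hR.trans hσ
          rw [integral_dampedIntegrand_eq_convolution hg t x hσ0]
          refine (enorm_convolution_far_le (integral_eq_zero_of_fourier hg) x ht hσ0
            hθ.le hθ').trans_eq ?_
          rw [ENNReal.ofReal_mul (by positivity)]
          ring
      _ = _ := by
          rw [lintegral_mul_const _ (by fun_prop), lintegral_rpow_Ioi hR hθ, ← mul_assoc,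
            ← mul_assoc, ← ENNReal.ofReal_mul (by positivity), ← ENNReal.ofReal_mul (by positivity)]
          congr 2
          field_simp
  have hsum : ∫⁻ y : 𝔼, ‖g y‖ₑ *
        ENNReal.ofReal (R ^ θ * |‖y - x‖ - t| ^ (-θ) + R ^ (-θ) * ‖y‖ ^ θ) =
      ENNReal.ofReal (R ^ θ) * Q₁ + ENNReal.ofReal (R ^ (-θ)) * Q₂ := by
    rw [hQ₁, hQ₂, ← lintegral_const_mul _ (by fun_prop), ← lintegral_const_mul _ (by fun_prop),
      ← lintegral_add_left (by fun_prop)]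
    refine lintegral_congr fun y => ?_
    rw [ENNReal.ofReal_add (by positivity) (by positivity), ENNReal.ofReal_mul (by positivity),
      ENNReal.ofReal_mul (by positivity)]
    ring
  rw [hsum, mul_add, halfWave_eq_integral]
  refine (enorm_integral_le_lintegral_enorm _).trans ?_
  rw [hsplit, lintegral_union measurableSet_Ioi (Set.Ioc_disjoint_Ioi le_rfl)]
  exact add_le_add hnear hfar

theorem sq_add_div_le {r d : ℝ} (hr : 0 < r) (hd : 0 < d) :
    ((d ^ (-(1 / 20) : ℝ) + r ^ (1 / 20 : ℝ)) / (r + r ^ 2)) ^ 2 ≤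
      4 * (1 + r) ^ (-4 : ℝ) *
        (3 + 2 * d ^ (-(1 / 2) : ℝ) + 2 * r ^ (-(5 / 2) : ℝ) + r ^ (1 / 2 : ℝ)) := by
  have hp : 0 < r ^ (1 / 20 : ℝ) := by positivity
  have hε : 0 < d ^ (-(1 / 20) : ℝ) := by positivity
  have h1 : d ^ (-(1 / 2) : ℝ) = (d ^ (-(1 / 20) : ℝ)) ^ 10 := by
    rw [← Real.rpow_mul_natCast hd.le]; norm_num
  have h2 : r ^ (-(5 / 2) : ℝ) = ((r ^ (1 / 20 : ℝ))⁻¹) ^ 50 := by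
    rw [← Real.rpow_neg hr.le, ← Real.rpow_mul_natCast hr.le]; norm_num
  have h3 : r ^ (1 / 2 : ℝ) = (r ^ (1 / 20 : ℝ)) ^ 10 := by
    rw [← Real.rpow_mul_natCast hr.le]; norm_num
  have h4 : r⁻¹ = ((r ^ (1 / 20 : ℝ))⁻¹) ^ 20 := by
    rw [← Real.rpow_neg hr.le, ← Real.rpow_mul_natCast hr.le, ← Real.rpow_neg_one]; norm_num
  have h5 : (1 + r) ^ (-4 : ℝ) = ((1 + r) ^ 4)⁻¹ := by
    rw [Real.rpow_neg (by positivity)]; norm_cast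
  rw [h1, h2, h3, h5]
  generalize d ^ (-(1 / 20) : ℝ) = ε at *
  generalize r ^ (1 / 20 : ℝ) = p at *
  have hq : 0 < p⁻¹ := inv_pos.2 hp
  have hpq : p * p⁻¹ = 1 := mul_inv_cancel₀ hp.ne'
  generalize p⁻¹ = q at *
  have pow_le : ∀ {a : ℝ} (m n : ℕ), 0 < a → m ≤ n → a ^ m ≤ 1 + a ^ n := by
    intro a m n ha hmn
    rcases le_total a 1 with h | h
    · exact (pow_le_one₀ ha.le h).trans (by have := pow_pos ha n; linarith)
    · exact (pow_le_pow_right₀ h hmn).trans (by linarith)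
  have e1 := pow_le 2 10 hε (by norm_num)
  have e2 := pow_le 2 10 hp (by norm_num)
  have e3 := pow_le 38 50 hq (by norm_num)
  have e4 : ε ^ 2 * q ^ 40 ≤ ε ^ 10 + q ^ 50 := by
    rcases le_total (ε ^ 2) (q ^ 10) with h | h
    · calc ε ^ 2 * q ^ 40 ≤ q ^ 10 * q ^ 40 := by gcongr
        _ = q ^ 50 := by ring
        _ ≤ _ := by have := pow_pos hε 10; linarith
    · calc ε ^ 2 * q ^ 40 = ε ^ 2 * (q ^ 10) ^ 4 := by ring
        _ ≤ ε ^ 2 * (ε ^ 2) ^ 4 := by gcongr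
        _ = ε ^ 10 := by ring
        _ ≤ _ := by have := pow_pos hq 50; linarith
  have e5 : p ^ 2 * q ^ 40 = q ^ 38 := by
    calc p ^ 2 * q ^ 40 = (p * q) ^ 2 * q ^ 38 := by ring
      _ = q ^ 38 := by rw [hpq]; ring
  have e6 : (ε + p) ^ 2 ≤ 2 * (ε ^ 2 + p ^ 2) := by nlinarith [sq_nonneg (ε - p)]
  have e7 : ((r + r ^ 2)⁻¹) ^ 2 ≤ 2 * ((1 + r) ^ 4)⁻¹ * (1 + q ^ 40) := by
    have : q ^ 40 = (r⁻¹) ^ 2 := by rw [h4]; ring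
    rw [this]
    have : 2 * ((1 + r) ^ 4)⁻¹ * (1 + r⁻¹ ^ 2) - ((r + r ^ 2)⁻¹) ^ 2 =
        (1 - r) ^ 2 / (r ^ 2 * (1 + r) ^ 4) := by
      field_simp
      ring
    have h : 0 ≤ (1 - r) ^ 2 / (r ^ 2 * (1 + r) ^ 4) := by positivity
    linarith
  rw [div_eq_mul_inv, mul_pow]
  calc _ ≤ 2 * (ε ^ 2 + p ^ 2) * (2 * ((1 + r) ^ 4)⁻¹ * (1 + q ^ 40)) := by gcongr
    _ = 4 * ((1 + r) ^ 4)⁻¹ * (ε ^ 2 + p ^ 2 + ε ^ 2 * q ^ 40 + p ^ 2 * q ^ 40) := by ring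
    _ ≤ _ := mul_le_mul_of_nonneg_left (by linarith) (by positivity)

/-- The locally singular part of `s ↦ |s| ^ (-1/2)`. -/
noncomputable def localSqrtInv : ℝ → ℝ :=
  (Set.Iio 1).indicator fun s => s ^ (-(1 / 2) : ℝ)

theorem measurable_localSqrtInv : Measurable localSqrtInv :=
  (measurable_id.pow_const _).indicator measurableSet_Iio

theorem rpow_le_one_add_localSqrtInv (d : ℝ) :
    d ^ (-(1 / 2) : ℝ) ≤ 1 + localSqrtInv d := by
  rcases lt_or_ge d 1 with h | h
  · simp [localSqrtInv, h]
  · have : d ^ (-(1 / 2) : ℝ) ≤ 1 := Real.rpow_le_one_of_one_le_of_nonpos h (by norm_num)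
    simpa [localSqrtInv, not_lt.2 h] using this

theorem localSqrtInv_nonneg {d : ℝ} (hd : 0 ≤ d) : 0 ≤ localSqrtInv d :=
  Set.indicator_apply_nonneg fun _ => Real.rpow_nonneg hd _

theorem integrableOn_localSqrtInv : IntegrableOn localSqrtInv (Set.Ioi 0) := by
  rw [localSqrtInv, integrableOn_indicator_iff measurableSet_Iio]
  have := (intervalIntegral.intervalIntegrable_rpow' (a := 0) (b := 1)
    (r := -(1 / 2)) (by norm_num))
  rw [intervalIntegrable_iff_integrableOn_Ioo_of_le zero_le_one] at this
  rwa [Set.inter_comm, Set.Ioi_inter_Iio]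

theorem integrable_localSqrtInv_abs : Integrable fun s : ℝ => localSqrtInv |s| := by
  refine (integrable_fun_norm_addHaar (volume : Measure ℝ) (f := localSqrtInv)).2 ?_
  simpa using integrableOn_localSqrtInv

theorem lintegral_localSqrtInv_le (t : ℝ) :
    ∫⁻ s in Set.Ioi 0, ENNReal.ofReal (localSqrtInv |s - t|) ≤
      ∫⁻ s : ℝ, ENNReal.ofReal (localSqrtInv |s|) :=
  (setLIntegral_le_lintegral _ _).trans
    (lintegral_sub_right_eq_self (fun s : ℝ => ENNReal.ofReal (localSqrtInv |s|)) t).le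

theorem integrable_one_add_norm_mul_rpow :
    Integrable fun y : 𝔼 => (1 + ‖y‖) ^ (-4 : ℝ) * ‖y‖ ^ (-(5 / 2) : ℝ) := by
  refine (integrable_fun_norm_addHaar (volume : Measure 𝔼)
    (f := fun r => (1 + r) ^ (-4 : ℝ) * r ^ (-(5 / 2) : ℝ))).2 ?_
  have h0 : IntegrableOn (fun r : ℝ => r ^ (-(1 / 2) : ℝ)) (Set.Ioc 0 1) := by
    have := (intervalIntegral.intervalIntegrable_rpow' (a := 0) (b := 1)
      (r := -(1 / 2)) (by norm_num))
    rwa [intervalIntegrable_iff_integrableOn_Ioc_of_le zero_le_one] at this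
  have h1 : IntegrableOn (fun r : ℝ => r ^ (-(9 / 2) : ℝ)) (Set.Ioi 1) :=
    integrableOn_Ioi_rpow_of_lt (by norm_num) one_pos
  simp only [finrank_euclideanSpace, Fintype.card_fin, Nat.add_one_sub_one, smul_eq_mul]
  rw [← Set.Ioc_union_Ioi_eq_Ioi zero_le_one]
  have hm : Measurable fun r : ℝ => r ^ 2 * ((1 + r) ^ (-4 : ℝ) * r ^ (-(5 / 2) : ℝ)) := by
    fun_prop
  refine IntegrableOn.union (Integrable.mono' h0 hm.aestronglyMeasurable ?_)
    (Integrable.mono' h1 hm.aestronglyMeasurable ?_)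
  · refine (ae_restrict_mem measurableSet_Ioc).mono fun r hr => ?_
    have hr0 : 0 < r := hr.1
    rw [Real.norm_of_nonneg (by positivity)]
    calc _ ≤ r ^ 2 * (1 * r ^ (-(5 / 2) : ℝ)) := by
          gcongr
          exact Real.rpow_le_one_of_one_le_of_nonpos (by linarith) (by norm_num)
      _ = r ^ (-(1 / 2) : ℝ) := by
          rw [one_mul, ← Real.rpow_natCast, ← Real.rpow_add hr0]; norm_num
  · refine (ae_restrict_mem measurableSet_Ioi).mono fun r hr => ?_
    have hr0 : 0 < r := one_pos.trans hr
    rw [Real.norm_of_nonneg (by positivity)]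
    calc _ ≤ r ^ 2 * (r ^ (-4 : ℝ) * r ^ (-(5 / 2) : ℝ)) := by
          gcongr r ^ 2 * (?_ * r ^ (-(5 / 2) : ℝ))
          exact Real.rpow_le_rpow_of_nonpos hr0 (by linarith) (by norm_num)
      _ = r ^ (-(9 / 2) : ℝ) := by
          rw [← Real.rpow_natCast, ← Real.rpow_add hr0, ← Real.rpow_add hr0]; norm_num

/-- The weighted kernel integral is bounded uniformly in the centre and radius of the cone. -/
theorem exists_lintegral_sq_add_div_le : ∃ K : ℝ, 0 < K ∧ ∀ (x : 𝔼) (t : ℝ), t ≠ 0 →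
    ∫⁻ y : 𝔼, ENNReal.ofReal (((|‖y - x‖ - t| ^ (-(1 / 20) : ℝ) + ‖y‖ ^ (1 / 20 : ℝ)) /
      (‖y‖ + ‖y‖ ^ 2)) ^ 2) ≤ ENNReal.ofReal K := by
  set I₁ : ℝ≥0∞ := ∫⁻ y : 𝔼, ENNReal.ofReal ((1 + ‖y‖) ^ (-(7 / 2) : ℝ)) with hI₁
  set I₂ : ℝ≥0∞ := ∫⁻ y : 𝔼, ENNReal.ofReal ((1 + ‖y‖) ^ (-4 : ℝ) * ‖y‖ ^ (-(5 / 2) : ℝ)) with hI₂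
  set I₃ : ℝ≥0∞ := 6 * (∫⁻ v : Fin 2 → ℝ, ENNReal.ofReal ((1 + ‖v‖) ^ (-4 : ℝ))) *
    ∫⁻ s : ℝ, ENNReal.ofReal (localSqrtInv |s|) with hI₃
  have h₁ : I₁ ≠ ∞ := (finite_integral_one_add_norm (by norm_num)).ne
  have h₂ : I₂ ≠ ∞ := integrable_one_add_norm_mul_rpow.lintegral_lt_top.ne
  have h₃ : I₃ ≠ ∞ := by
    refine ENNReal.mul_ne_top (ENNReal.mul_ne_top (by simp) ?_)
      integrable_localSqrtInv_abs.lintegral_lt_top.ne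
    exact (finite_integral_one_add_norm (by norm_num)).ne
  have hfin : 24 * I₁ + 8 * I₂ + 8 * I₃ ≠ ∞ := by finiteness
  refine ⟨(24 * I₁ + 8 * I₂ + 8 * I₃).toReal + 1, by positivity, fun x t ht => ?_⟩
  have hae : ∀ᵐ y : 𝔼, y ≠ 0 := by simp [ae_iff, measure_singleton]
  have hae' : ∀ᵐ y : 𝔼, ‖y - x‖ ≠ t := by
    have := Measure.addHaar_sphere_of_ne_zero (volume : Measure 𝔼) x ht
    simpa [ae_iff, Metric.sphere, dist_eq_norm] using this
  calc _ ≤ ∫⁻ y : 𝔼, (24 * ENNReal.ofReal ((1 + ‖y‖) ^ (-(7 / 2) : ℝ)) +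
        8 * ENNReal.ofReal ((1 + ‖y‖) ^ (-4 : ℝ) * ‖y‖ ^ (-(5 / 2) : ℝ))) +
        8 * (ENNReal.ofReal ((1 + ‖y‖) ^ (-4 : ℝ)) *
          ENNReal.ofReal (localSqrtInv |‖y - x‖ - t|)) := by
        refine lintegral_mono_ae ?_
        filter_upwards [hae, hae'] with y hy hy'
        have hr : 0 < ‖y‖ := norm_pos_iff.2 hy
        have hd : 0 < |‖y - x‖ - t| := abs_pos.2 (sub_ne_zero.2 hy')
        have hl := localSqrtInv_nonneg hd.le
        rw [← ENNReal.ofReal_mul (by positivity), ← ENNReal.ofReal_ofNat 24,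
          ← ENNReal.ofReal_ofNat 8, ← ENNReal.ofReal_mul (by positivity),
          ← ENNReal.ofReal_mul (by positivity), ← ENNReal.ofReal_mul (by positivity),
          ← ENNReal.ofReal_add (by positivity) (by positivity),
          ← ENNReal.ofReal_add (by positivity) (by positivity)]
        refine ENNReal.ofReal_le_ofReal ((sq_add_div_le hr hd).trans ?_)
        have e1 := rpow_le_one_add_localSqrtInv |‖y - x‖ - t|
        have e2 : 5 + ‖y‖ ^ (1 / 2 : ℝ) ≤ 6 * (1 + ‖y‖) ^ (1 / 2 : ℝ) := by
          have a1 : 1 ≤ (1 + ‖y‖) ^ (1 / 2 : ℝ) :=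
            Real.one_le_rpow (by linarith) (by norm_num)
          have a2 : ‖y‖ ^ (1 / 2 : ℝ) ≤ (1 + ‖y‖) ^ (1 / 2 : ℝ) := by gcongr; linarith
          linarith
        have e3 : (1 + ‖y‖) ^ (-(7 / 2) : ℝ) =
            (1 + ‖y‖) ^ (-4 : ℝ) * (1 + ‖y‖) ^ (1 / 2 : ℝ) := by
          rw [← Real.rpow_add (by positivity)]; norm_num
        rw [e3]
        have hw : 0 ≤ 4 * (1 + ‖y‖) ^ (-4 : ℝ) := by positivity
        calc _ ≤ 4 * (1 + ‖y‖) ^ (-4 : ℝ) * (6 * (1 + ‖y‖) ^ (1 / 2 : ℝ) +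
              2 * ‖y‖ ^ (-(5 / 2) : ℝ) + 2 * localSqrtInv |‖y - x‖ - t|) :=
              mul_le_mul_of_nonneg_left (by linarith) hw
          _ = _ := by ring
    _ = 24 * I₁ + 8 * I₂ + 8 * ∫⁻ y : 𝔼, ENNReal.ofReal ((1 + ‖y‖) ^ (-4 : ℝ)) *
          ENNReal.ofReal (localSqrtInv |‖y - x‖ - t|) := by
        rw [lintegral_add_left (by fun_prop), lintegral_add_left (by fun_prop),
          lintegral_const_mul _ (by fun_prop), lintegral_const_mul _ (by fun_prop),
          lintegral_const_mul' _ _ (by simp)]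
    _ ≤ 24 * I₁ + 8 * I₂ + 8 * I₃ := by
        gcongr
        have hH : Measurable fun s : ℝ => ENNReal.ofReal (localSqrtInv |s - t|) :=
          (measurable_localSqrtInv.comp (by fun_prop)).ennreal_ofReal
        refine (lintegral_weight_mul_radial_le hH x).trans ?_
        rw [hI₃]
        exact mul_le_mul_right (lintegral_localSqrtInv_le t) _
    _ ≤ _ := by
        rw [ENNReal.ofReal_add ENNReal.toReal_nonneg zero_le_one, ENNReal.ofReal_toReal hfin]
        exact le_self_add

theorem lintegral_eq_mul_lintegral_comp_smul {R : ℝ} (hR : 0 < R) (F : 𝔼 → ℝ≥0∞) :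
    ∫⁻ y, F y = ENNReal.ofReal (R ^ 3) * ∫⁻ y, F (R • y) := by
  have h := (Homeomorph.smulOfNeZero R hR.ne' : 𝔼 ≃ₜ 𝔼).measurableEmbedding.lintegral_map
    (μ := volume) F
  have h' : Measure.map (Homeomorph.smulOfNeZero R hR.ne' : 𝔼 ≃ₜ 𝔼) volume =
      ENNReal.ofReal |(R ^ Module.finrank ℝ 𝔼)⁻¹| • (volume : Measure 𝔼) :=
    Measure.map_addHaar_smul volume hR.ne'
  rw [h', lintegral_smul_measure] at h
  simp only [Homeomorph.smulOfNeZero_apply] at h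
  rw [← h, finrank_euclideanSpace, Fintype.card_fin, abs_of_pos (by positivity), smul_eq_mul,
    ← mul_assoc, ← ENNReal.ofReal_mul (by positivity), mul_inv_cancel₀ (by positivity)]
  simp

theorem lintegral_sq_scaled_le {K : ℝ} (hK : ∀ (x : 𝔼) (t : ℝ), t ≠ 0 →
      ∫⁻ y : 𝔼, ENNReal.ofReal (((|‖y - x‖ - t| ^ (-(1 / 20) : ℝ) + ‖y‖ ^ (1 / 20 : ℝ)) /
        (‖y‖ + ‖y‖ ^ 2)) ^ 2) ≤ ENNReal.ofReal K)
    (x : 𝔼) {t R : ℝ} (ht : 0 < t) (hR : 0 < R) :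
    ∫⁻ y : 𝔼, ENNReal.ofReal (((R ^ (1 / 20 : ℝ) * |‖y - x‖ - t| ^ (-(1 / 20) : ℝ) +
      R ^ (-(1 / 20) : ℝ) * ‖y‖ ^ (1 / 20 : ℝ)) / (R * ‖y‖ + ‖y‖ ^ 2)) ^ 2) ≤
      ENNReal.ofReal (R⁻¹ * K) := by
  have key : ∀ y : 𝔼, ENNReal.ofReal (((R ^ (1 / 20 : ℝ) * |‖R • y - x‖ - t| ^ (-(1 / 20) : ℝ) +
      R ^ (-(1 / 20) : ℝ) * ‖R • y‖ ^ (1 / 20 : ℝ)) / (R * ‖R • y‖ + ‖R • y‖ ^ 2)) ^ 2) =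
      ENNReal.ofReal ((R ^ 4)⁻¹) * ENNReal.ofReal
        (((|‖y - R⁻¹ • x‖ - R⁻¹ * t| ^ (-(1 / 20) : ℝ) + ‖y‖ ^ (1 / 20 : ℝ)) /
        (‖y‖ + ‖y‖ ^ 2)) ^ 2) := by
    intro y
    have h1 : |‖R • y - x‖ - t| = R * |‖y - R⁻¹ • x‖ - R⁻¹ * t| := by
      have : R • y - x = R • (y - R⁻¹ • x) := by rw [smul_sub, smul_inv_smul₀ hR.ne']
      rw [this, norm_smul, Real.norm_of_nonneg hR.le]
      conv_rhs => rw [← abs_of_pos hR, ← abs_mul, abs_of_pos hR]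
      congr 1
      field_simp
    have h2 : R ^ (1 / 20 : ℝ) * R ^ (-(1 / 20) : ℝ) = 1 := by
      rw [← Real.rpow_add hR]; norm_num
    rw [h1, norm_smul, Real.norm_of_nonneg hR.le, Real.mul_rpow hR.le (abs_nonneg _),
      Real.mul_rpow hR.le (norm_nonneg _), ← mul_assoc, ← mul_assoc, mul_comm (R ^ (-(1 / 20) : ℝ)),
      h2, one_mul, one_mul, ← ENNReal.ofReal_mul (by positivity)]
    congr 1
    have : R * (R * ‖y‖) + (R * ‖y‖) ^ 2 = R ^ 2 * (‖y‖ + ‖y‖ ^ 2) := by ring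
    rw [this, div_pow, div_pow, mul_pow, ← pow_mul, div_eq_mul_inv, div_eq_mul_inv, mul_inv]
    ring
  rw [lintegral_eq_mul_lintegral_comp_smul hR]
  simp only [key]
  rw [lintegral_const_mul' _ _ ENNReal.ofReal_ne_top, ← mul_assoc,
    ← ENNReal.ofReal_mul (by positivity)]
  have : R ^ 3 * (R ^ 4)⁻¹ = R⁻¹ := by field_simp
  rw [this, ENNReal.ofReal_mul (by positivity)]
  gcongr
  exact hK _ _ (by positivity)

theorem lintegral_mul_le_eLpNorm_mul_sqrt (g : SchwartzMap 𝔼 ℂ) {k : 𝔼 → ℝ} (hk : Measurable k)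
    (hk0 : ∀ y, 0 ≤ k y) {R L : ℝ} (hR : 0 < R)
    (hL : ∫⁻ y, ENNReal.ofReal ((k y / (R * ‖y‖ + ‖y‖ ^ 2)) ^ 2) ≤ ENNReal.ofReal L) :
    ∫⁻ y, ‖g y‖ₑ * ENNReal.ofReal (k y) ≤
      (ENNReal.ofReal R * eLpNorm (fun y => ‖y‖ • g y) 2 volume +
        eLpNorm (fun y => (‖y‖ ^ 2 : ℝ) • g y) 2 volume) * ENNReal.ofReal L ^ ((1 : ℝ) / 2) := by
  have hg := g.continuous
  have hae : ∀ᵐ y : 𝔼, y ≠ 0 := by simp [ae_iff, measure_singleton]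
  set G : 𝔼 → ℂ := fun y => (R * ‖y‖ + ‖y‖ ^ 2 : ℝ) • g y with hG
  have hGc : Continuous G := by fun_prop
  have h1 : eLpNorm G 2 volume ≤ ENNReal.ofReal R * eLpNorm (fun y => ‖y‖ • g y) 2 volume +
      eLpNorm (fun y => (‖y‖ ^ 2 : ℝ) • g y) 2 volume := by
    have e : G = (R • fun y => ‖y‖ • g y) + fun y => (‖y‖ ^ 2 : ℝ) • g y := by
      ext y
      simp [hG, add_mul, mul_assoc]
    rw [e]
    refine (eLpNorm_add_le ?_ ?_ (by norm_num)).trans ?_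
    · exact Continuous.aestronglyMeasurable (by fun_prop)
    · exact Continuous.aestronglyMeasurable (by fun_prop)
    · rw [eLpNorm_const_smul, Real.enorm_of_nonneg hR.le]
  calc ∫⁻ y, ‖g y‖ₑ * ENNReal.ofReal (k y)
      = ∫⁻ y, ((fun y => ‖G y‖ₑ) * fun y => ENNReal.ofReal (k y / (R * ‖y‖ + ‖y‖ ^ 2))) y := by
        refine lintegral_congr_ae (hae.mono fun y hy => ?_)
        have h0 : 0 < ‖y‖ := norm_pos_iff.2 hy
        have hW : 0 < R * ‖y‖ + ‖y‖ ^ 2 := by positivity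
        simp only [Pi.mul_apply, hG, enorm_smul, Real.enorm_of_nonneg hW.le]
        rw [mul_comm (ENNReal.ofReal _), mul_assoc, ← ENNReal.ofReal_mul hW.le,
          mul_div_cancel₀ _ hW.ne']
    _ ≤ _ := ENNReal.lintegral_mul_le_Lp_mul_Lq volume Real.HolderConjugate.two_two
        hGc.enorm.aemeasurable (by fun_prop)
    _ ≤ _ := by
        gcongr
        · refine le_trans (le_of_eq ?_) h1
          rw [eLpNorm_eq_lintegral_rpow_enorm_toReal (by norm_num) (by norm_num)]
          simp
        · refine le_trans (le_of_eq ?_) hL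
          refine lintegral_congr fun y => ?_
          have := hk0 y
          rw [ENNReal.ofReal_pow (by positivity)]
          norm_cast

/-- Optimising a family of bounds linear in a scale parameter. -/
theorem le_mul_sqrt_mul_sqrt {a A B : ℝ≥0∞} {c K : ℝ} (hc : 0 < c) (hK : 0 < K)
    (h0 : A = 0 ↔ B = 0)
    (h : ∀ R : ℝ, 0 < R → a ≤ ENNReal.ofReal c *
      ((ENNReal.ofReal R * A + B) * ENNReal.ofReal (R⁻¹ * K) ^ ((1 : ℝ) / 2))) :
    a ≤ ENNReal.ofReal (2 * c * √K) * A ^ ((1 : ℝ) / 2) * B ^ ((1 : ℝ) / 2) := by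
  by_cases hA : A = 0
  · have hB := h0.1 hA
    simpa [hA, hB] using h 1 one_pos
  have hB : B ≠ 0 := mt h0.2 hA
  have hC : ENNReal.ofReal (2 * c * √K) ≠ 0 := by
    simp only [ne_eq, ENNReal.ofReal_eq_zero, not_le]; positivity
  by_cases hA' : A = ∞
  · simp [hA', hC, hB, ENNReal.mul_top]
  by_cases hB' : B = ∞
  · simp [hB', hC, hA, ENNReal.mul_top]
  lift A to NNReal using hA'
  lift B to NNReal using hB'
  have hA0 : 0 < (A : ℝ) := by simpa [pos_iff_ne_zero] using hA
  have hB0 : 0 < (B : ℝ) := by simpa [pos_iff_ne_zero] using hB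
  refine (h (B / A) (by positivity)).trans (le_of_eq ?_)
  rw [← ENNReal.ofReal_coe_nnreal, ← ENNReal.ofReal_coe_nnreal,
    ENNReal.ofReal_rpow_of_pos (by positivity), ENNReal.ofReal_rpow_of_pos (by positivity),
    ENNReal.ofReal_rpow_of_pos (by positivity), ← ENNReal.ofReal_mul (by positivity),
    ← ENNReal.ofReal_add (by positivity) (by positivity), ← ENNReal.ofReal_mul (by positivity),
    ← ENNReal.ofReal_mul (by positivity), ← ENNReal.ofReal_mul (by positivity),
    ← ENNReal.ofReal_mul (by positivity)]
  congr 1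
  simp only [← Real.sqrt_eq_rpow]
  rw [div_mul_cancel₀ _ hA0.ne', inv_div, Real.sqrt_mul (by positivity), Real.sqrt_div hA0.le]
  have := Real.mul_self_sqrt hB0.le
  have hs : √(B : ℝ) ≠ 0 := by positivity
  field_simp
  linear_combination -2 * this

theorem eLpNorm_norm_smul_eq_zero_iff (g : SchwartzMap 𝔼 ℂ) {n : ℕ} :
    eLpNorm (fun y => (‖y‖ ^ n : ℝ) • g y) 2 volume = 0 ↔ ∀ᵐ y, g y = 0 := by
  have hg := g.continuous
  have hae : ∀ᵐ y : 𝔼, y ≠ 0 := by simp [ae_iff, measure_singleton]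
  rw [eLpNorm_eq_zero_iff (Continuous.aestronglyMeasurable (by fun_prop)) (by norm_num)]
  refine Filter.eventually_congr (hae.mono fun y hy => ?_)
  simp [hy]

/-- Dispersive estimate: ‖e^{itΛ}f‖_∞ ≤ (C/t) ‖|x|Λ²f‖₂^{1/2} ‖|x|²Λ²f‖₂^{1/2}. -/
theorem halfWave_dispersive_weighted :
    ∃ C : ℝ, 0 < C ∧ ∀ (f : SchwartzMap (EuclideanSpace ℝ (Fin 3)) ℂ) (t : ℝ), 0 < t →
      eLpNorm (halfWave t ⇑f) ⊤ volume ≤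
        ENNReal.ofReal (C / t) *
          (eLpNorm (fun x : EuclideanSpace ℝ (Fin 3) => ‖x‖ • lambdaPow 2 ⇑f x) 2 volume)
            ^ ((1 : ℝ) / 2) *
          (eLpNorm (fun x : EuclideanSpace ℝ (Fin 3) => (‖x‖ ^ 2 : ℝ) • lambdaPow 2 ⇑f x) 2
              volume) ^ ((1 : ℝ) / 2) := by
  obtain ⟨K, hK0, hK⟩ := exists_lintegral_sq_add_div_le
  refine ⟨80 * √K, by positivity, fun f t ht => ?_⟩
  obtain ⟨g, hfg, hg⟩ := exists_schwartz_lambdaPow_two f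
  rw [hfg, eLpNorm_exponent_top]
  refine eLpNormEssSup_le_of_ae_enorm_bound (ae_of_all _ fun x => ?_)
  have hC : 80 * √K / t = 2 * (40 / t) * √K := by ring
  rw [hC]
  refine le_mul_sqrt_mul_sqrt (by positivity) hK0 ?_ fun R hR => ?_
  · simpa using (eLpNorm_norm_smul_eq_zero_iff g (n := 1)).trans
      (eLpNorm_norm_smul_eq_zero_iff g (n := 2)).symm
  · have h := enorm_halfWave_le_lintegral hg x ht hR (θ := 1 / 20) (by norm_num) (by norm_num)
    have hc : 2 / (t * (1 / 20)) = 40 / t := by field_simp; norm_num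
    rw [hc] at h
    refine h.trans ?_
    gcongr
    exact lintegral_mul_le_eLpNorm_mul_sqrt g (by fun_prop) (fun y => by positivity) hR
      (lintegral_sq_scaled_le hK x ht hR)
end

section
/- For every real s > 3/2 there exists a constant C > 0 such that for every Schwartz function f : ℝ³ → ℂ and every t > 0, ‖e^{itΛ} f‖_{L^∞(ℝ³)} ≤ (C/t) · ‖ (1 + ‖x‖²)^{s/2} Λ²f ‖_{L²(ℝ³)}. -/
open MeasureTheory
open scoped InnerProductSpace FourierTransform ENNReal

lemma norm_log_sub_log_le {w : ℂ} {r δ : ℝ} (hw : 0 < w.re) (hr : 0 ≤ r) (hδ : 0 < δ)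
    (h : ∀ σ ∈ Set.Icc (-r) r, δ ≤ ‖w + σ * Complex.I‖) :
    ‖Complex.log (w + r * Complex.I) - Complex.log (w - r * Complex.I)‖ ≤ 2 * r / δ := by
  have key : ∀ σ ∈ Set.Icc (-r) r, HasDerivWithinAt
      (fun σ : ℝ => Complex.log (w + σ * Complex.I)) (Complex.I / (w + σ * Complex.I))
      (Set.Icc (-r) r) σ := by
    intro σ _
    have h1 : HasDerivAt (fun σ : ℝ => w + σ * Complex.I) Complex.I σ := by
      simpa using ((Complex.ofRealCLM.hasDerivAt (x := σ)).mul_const Complex.I).const_add w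
    exact (h1.clog_real (Or.inl (by simpa using hw))).hasDerivWithinAt
  have := (convex_Icc (-r) r).norm_image_sub_le_of_norm_hasDerivWithin_le (C := 1 / δ) key
    (fun σ hσ => by
      rw [norm_div, Complex.norm_I]
      exact one_div_le_one_div_of_le hδ (h σ hσ))
    (Set.left_mem_Icc.2 (by linarith)) (Set.right_mem_Icc.2 (by linarith))
  have e : r - -r = 2 * r := by ring
  rw [e, Real.norm_of_nonneg (by linarith : 0 ≤ 2 * r)] at this
  simp only [Complex.ofReal_neg, neg_mul, ← sub_eq_add_neg] at this
  calc _ ≤ _ := this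
    _ = _ := by ring

lemma norm_mul_add_ofReal_le {t r c M : ℝ} {L : ℂ} (ht : 0 < t) (hr : 0 < r)
    (hrt : t / r ≤ 2) (hi : |L.im| ≤ 2 * Real.pi) (hre : |(t / r) * L.re + c| ≤ M) :
    ‖(t / r : ℂ) * L + c‖ ≤ M + 16 := by
  have e : (t / r : ℂ) = ((t / r : ℝ) : ℂ) := by push_cast; ring
  rw [e]
  refine (Complex.norm_le_abs_re_add_abs_im _).trans ?_
  have h1 : (((t / r : ℝ) : ℂ) * L + c).re = (t / r) * L.re + c := by simp [-Complex.ofReal_div]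
  have h2 : (((t / r : ℝ) : ℂ) * L + c).im = (t / r) * L.im := by simp [-Complex.ofReal_div]
  rw [h1, h2, abs_mul, abs_of_pos (by positivity : 0 < t / r)]
  have : t / r * |L.im| ≤ 2 * (2 * Real.pi) := by gcongr
  have := Real.pi_le_four
  linarith

lemma abs_mul_log_add_log_le {t r ε η d q Q R : ℝ} (ht : 0 < t) (hr : 0 < r)
    (hε1 : ε ≤ 1) (hεt : ε ≤ t) (hd : 0 ≤ d) (hη : |q - d| ≤ η)
    (hqdef : |r - t| = q) (hq0 : 0 < q) (hQq : q ≤ Q) (hQ' : Q ≤ q + ε) (hRl : r + t ≤ R)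
    (hRu : R ≤ r + t + ε) (hqt : q ≤ t / 2) :
    |(t / r) * (Real.log Q - Real.log R) + Real.log (1 + t / (1 + d))| ≤
      24 + Real.log (1 + η) + Real.log (1 + 1 / q) := by
  have hη0 : 0 ≤ η := (abs_nonneg _).trans hη
  obtain ⟨hη1, hη2⟩ := abs_le.1 hη
  obtain ⟨hrt3, hrt4⟩ := abs_le.1 hqdef.le
  have hlη : 0 ≤ Real.log (1 + η) := Real.log_nonneg (by linarith)
  have hlq : 0 ≤ Real.log (1 + 1 / q) := Real.log_nonneg (by
    have : 0 < 1 / q := by positivity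
    linarith)
  have hQ0 : 0 < Q := hq0.trans_le hQq
  have hR0 : 0 < R := by linarith
  set c := Real.log (1 + t / (1 + d)) with hc
  have hlog : |Real.log Q - Real.log R| ≤ 5 * t / Q := by
    rw [abs_sub_comm, ← Real.log_div hR0.ne' hQ0.ne']
    have h1 : Real.log (R / Q) ≤ R / Q := (Real.log_le_sub_one_of_pos (by positivity)).trans
      (by linarith)
    have h0 : 0 ≤ Real.log (R / Q) := Real.log_nonneg (by
      rw [le_div_iff₀ hQ0]; linarith)
    rw [abs_of_nonneg h0]
    refine h1.trans ?_
    gcongr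
    linarith
  have hA : |(t / r - 1) * (Real.log Q - Real.log R)| ≤ 10 := by
    rw [abs_mul]
    have h1 : |t / r - 1| ≤ 2 * Q / t := by
      have : t / r - 1 = (t - r) / r := by field_simp
      rw [this, abs_div, abs_of_pos hr, abs_sub_comm, hqdef, div_le_div_iff₀ hr ht]
      nlinarith
    calc _ ≤ 2 * Q / t * (5 * t / Q) := by gcongr
      _ = 10 := by field_simp; norm_num
  have hRt : Real.log R - Real.log t ≤ 4 := by
    rw [← Real.log_div hR0.ne' ht.ne']
    have h10 : R / t ≤ 5 := by
      rw [div_le_iff₀ ht]; linarith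
    have := Real.log_le_sub_one_of_pos (show 0 < R / t by positivity)
    linarith
  have hRt' : 0 ≤ Real.log R - Real.log t := by
    rw [sub_nonneg]; exact Real.log_le_log ht (by linarith)
  have hc1 : c = Real.log (1 + d + t) - Real.log (1 + d) := by
    rw [hc, ← Real.log_div (by positivity) (by positivity)]
    congr 1
    field_simp
  have hup : Real.log t - Real.log Q - c ≤ Real.log (1 + η) + Real.log (1 + 1 / q) := by
    have h1 : Real.log t ≤ Real.log (1 + d + t) := Real.log_le_log ht (by linarith)
    have h2 : Real.log (1 + d) - Real.log Q ≤ Real.log (1 + η) + Real.log (1 + 1 / q) := by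
      rw [← Real.log_div (by positivity) hQ0.ne', ← Real.log_mul (by positivity) (by positivity)]
      refine Real.log_le_log (by positivity) ?_
      calc (1 + d) / Q ≤ (1 + Q + η) / Q := div_le_div_of_nonneg_right (by linarith) hQ0.le
        _ ≤ (1 + η) * (1 + 1 / Q) := by
          rw [div_le_iff₀ hQ0]
          have : (1 + η) * (1 + 1 / Q) * Q = (1 + η) * (Q + 1) := by field_simp
          rw [this]
          nlinarith
        _ ≤ _ := by gcongr
    linarith
  have hlow : c - (Real.log t - Real.log Q) ≤ 2 + Real.log (1 + η) := by
    have e : c - (Real.log t - Real.log Q) = Real.log ((Q * (1 + d + t)) / ((1 + d) * t)) := by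
      rw [Real.log_div (by positivity) (by positivity), Real.log_mul (by positivity)
        (by positivity), Real.log_mul (by positivity) (by positivity), hc1]
      ring
    rw [e]
    calc _ ≤ Real.log (3 * (1 + η)) := by
          refine Real.log_le_log (by positivity) ?_
          rw [div_le_iff₀ (by positivity)]
          have h1 : Q ≤ (1 + η) * (1 + d) := by linarith [mul_nonneg hη0 hd]
          have h2 : Q ≤ 3 / 2 * t := by linarith
          have h3 : Q * t ≤ (1 + η) * (1 + d) * t := mul_le_mul_of_nonneg_right h1 ht.le
          have h4 : Q * (1 + d) ≤ 3 / 2 * t * (1 + d) :=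
            mul_le_mul_of_nonneg_right h2 (by positivity)
          have h5 : 0 ≤ η * t * (1 + d) := by positivity
          have h6 : 0 ≤ t * (1 + d) := by positivity
          linarith
      _ = Real.log 3 + Real.log (1 + η) := Real.log_mul (by norm_num) (by positivity)
      _ ≤ _ := by
        have := Real.log_le_sub_one_of_pos (show (0:ℝ) < 3 by norm_num)
        linarith
  have e : (t / r) * (Real.log Q - Real.log R) + c = (t / r - 1) * (Real.log Q - Real.log R)
    + ((Real.log Q - Real.log R) + c) := by ring
  rw [e]
  refine (abs_add_le _ _).trans ?_
  have : |Real.log Q - Real.log R + c| ≤ 6 + Real.log (1 + η) + Real.log (1 + 1 / q) :=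
    abs_le.2 ⟨by linarith, by linarith⟩
  linarith

lemma norm_kernel_log_le {t r ε η d : ℝ} (ht : 0 < t) (hr : 0 < r) (hε : 0 < ε) (hε1 : ε ≤ 1)
    (hεt : ε ≤ t) (hq : r ≠ t) (hd : 0 ≤ d) (hη : |(|r - t|) - d| ≤ η) :
    ‖(t / r : ℂ) * (Complex.log ((ε - t * Complex.I) + r * Complex.I) -
      Complex.log ((ε - t * Complex.I) - r * Complex.I)) + (Real.log (1 + t / (1 + d)) : ℝ)‖
      ≤ 40 + Real.log (1 + η) + Real.log (1 + 1 / |r - t|) := by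
  set L := Complex.log ((ε - t * Complex.I) + r * Complex.I) -
      Complex.log ((ε - t * Complex.I) - r * Complex.I) with hL
  set q := |r - t| with hqdef
  have hq0 : 0 < q := abs_pos.2 (sub_ne_zero.2 hq)
  have hη0 : 0 ≤ η := (abs_nonneg _).trans hη
  obtain ⟨hη1, hη2⟩ := abs_le.1 hη
  have hlη : 0 ≤ Real.log (1 + η) := Real.log_nonneg (by linarith)
  have hlq : 0 ≤ Real.log (1 + 1 / q) := Real.log_nonneg (by
    have : 0 < 1 / q := by positivity
    linarith)
  set c := Real.log (1 + t / (1 + d)) with hc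
  have hc0 : 0 ≤ c := Real.log_nonneg (by
    have : 0 < t / (1 + d) := by positivity
    linarith)
  have hcfar : t ≤ 2 * q → c ≤ 2 + Real.log (1 + η) := by
    intro h
    have h1 : 1 + t / (1 + d) ≤ 3 * (1 + η) := by
      have : t / (1 + d) ≤ 2 * (1 + η) := by
        rw [div_le_iff₀ (by positivity)]
        nlinarith
      linarith
    calc c ≤ Real.log (3 * (1 + η)) := Real.log_le_log (by positivity) h1
      _ = Real.log 3 + Real.log (1 + η) := Real.log_mul (by norm_num) (by positivity)
      _ ≤ _ := by
        have := Real.log_le_sub_one_of_pos (show (0:ℝ) < 3 by norm_num)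
        linarith
  by_cases hnear : r ≤ t / 2
  · have hLn : ‖L‖ ≤ 2 * r / (t / 2) := by
      refine norm_log_sub_log_le (by simpa using hε) hr.le (by positivity) ?_
      intro σ hσ
      refine le_trans ?_ (Complex.abs_im_le_norm _)
      have : ((ε : ℂ) - t * Complex.I + σ * Complex.I).im = - (t - σ) := by simp; ring
      rw [this, abs_neg]
      refine le_trans ?_ (le_abs_self _)
      linarith [hσ.2]
    have h4 : ‖(t / r : ℂ) * L‖ ≤ 4 := by
      rw [norm_mul, norm_div, Complex.norm_real, Complex.norm_real, Real.norm_of_nonneg ht.le,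
        Real.norm_of_nonneg hr.le]
      calc t / r * ‖L‖ ≤ t / r * (2 * r / (t / 2)) := by gcongr
        _ = 4 := by field_simp; norm_num
    have hqt : t ≤ 2 * q := by
      rw [hqdef, abs_sub_comm]
      linarith [le_abs_self (t - r)]
    have := hcfar hqt
    refine (norm_add_le _ _).trans ?_
    rw [Complex.norm_real, Real.norm_of_nonneg hc0]
    linarith
  push Not at hnear
  have hrt2 : t / r ≤ 2 := by
    rw [div_le_iff₀ hr]; linarith
  set Q := ‖((ε - t * Complex.I) + r * Complex.I : ℂ)‖ with hQ
  set R := ‖((ε - t * Complex.I) - r * Complex.I : ℂ)‖ with hR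
  have him : |L.im| ≤ 2 * Real.pi := by
    rw [hL, Complex.sub_im, Complex.log_im, Complex.log_im]
    have := abs_sub (Complex.arg ((ε - t * Complex.I) + r * Complex.I))
      (Complex.arg ((ε - t * Complex.I) - r * Complex.I))
    have h1 := Complex.abs_arg_le_pi ((ε - t * Complex.I) + r * Complex.I)
    have h2 := Complex.abs_arg_le_pi ((ε - t * Complex.I) - r * Complex.I)
    linarith
  have hre : L.re = Real.log Q - Real.log R := by
    rw [hL, Complex.sub_re, Complex.log_re, Complex.log_re]
  have hQq : q ≤ Q := by
    have := Complex.abs_im_le_norm ((ε - t * Complex.I) + r * Complex.I : ℂ)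
    have e : ((ε - t * Complex.I) + r * Complex.I : ℂ).im = r - t := by simp; ring
    rwa [e] at this
  have hQ' : Q ≤ q + ε := by
    have := Complex.norm_le_abs_re_add_abs_im ((ε - t * Complex.I) + r * Complex.I : ℂ)
    have e : ((ε - t * Complex.I) + r * Complex.I : ℂ).im = r - t := by simp; ring
    have e' : ((ε - t * Complex.I) + r * Complex.I : ℂ).re = ε := by simp
    rw [e, e', abs_of_pos hε] at this
    linarith
  have hRl : r + t ≤ R := by
    have := Complex.abs_im_le_norm ((ε - t * Complex.I) - r * Complex.I : ℂ)
    have e : ((ε - t * Complex.I) - r * Complex.I : ℂ).im = -(r + t) := by simp; ring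
    rw [e, abs_neg, abs_of_pos (by linarith)] at this
    exact this
  have hRu : R ≤ r + t + ε := by
    have := Complex.norm_le_abs_re_add_abs_im ((ε - t * Complex.I) - r * Complex.I : ℂ)
    have e : ((ε - t * Complex.I) - r * Complex.I : ℂ).im = -(r + t) := by simp; ring
    have e' : ((ε - t * Complex.I) - r * Complex.I : ℂ).re = ε := by simp
    rw [e, e', abs_neg, abs_of_pos hε, abs_of_pos (by linarith : 0 < r + t)] at this
    linarith
  have hQ0 : 0 < Q := hq0.trans_le hQq
  have hR0 : 0 < R := by linarith
  have hqrt : q ≤ r + t := by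
    rw [hqdef]; exact abs_le.2 ⟨by linarith, by linarith⟩
  suffices h : |(t / r) * L.re + c| ≤ 24 + Real.log (1 + η) + Real.log (1 + 1 / q) by
    have := norm_mul_add_ofReal_le ht hr hrt2 him h
    linarith
  rw [hre]
  by_cases hfar : 3 * t / 2 ≤ r
  · have hqe : q = r - t := abs_of_pos (by linarith)
    have h1 : Real.log R - Real.log Q ≤ 9 := by
      rw [← Real.log_div hR0.ne' hQ0.ne']
      have h10 : R / Q ≤ 10 := by
        rw [div_le_iff₀ hQ0]; linarith
      have := Real.log_le_sub_one_of_pos (show 0 < R / Q by positivity)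
      linarith
    have h2 : Real.log Q - Real.log R ≤ 1 := by
      rw [← Real.log_div hQ0.ne' hR0.ne']
      have h10 : Q / R ≤ 2 := by
        rw [div_le_iff₀ hR0]; linarith
      have := Real.log_le_sub_one_of_pos (show 0 < Q / R by positivity)
      linarith
    have h3 : |(t / r) * (Real.log Q - Real.log R)| ≤ 18 := by
      rw [abs_mul, abs_of_pos (by positivity : 0 < t / r)]
      have : |Real.log Q - Real.log R| ≤ 9 := abs_le.2 ⟨by linarith, by linarith⟩
      calc _ ≤ 2 * (9 : ℝ) := by gcongr
        _ = 18 := by norm_num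
    have := hcfar (by linarith)
    refine (abs_add_le _ _).trans ?_
    rw [abs_of_nonneg hc0]
    linarith
  push Not at hfar
  have hqt : q ≤ t / 2 := by rw [hqdef]; exact abs_le.2 ⟨by linarith, by linarith⟩
  exact abs_mul_log_add_log_le ht hr hε1 hεt hd hη hqdef.symm hq0 hQq hQ' hRl hRu hqt

lemma integrable_exp_neg_norm_div_pow {b : ℝ} (hb : 0 < b) {k : ℕ} (hk : k ≤ 2) :
    Integrable (fun ξ : EuclideanSpace ℝ (Fin 3) => Real.exp (-b * ‖ξ‖) / ‖ξ‖ ^ k) := by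
  rw [integrable_fun_norm_addHaar volume (f := fun y => Real.exp (-b * y) / y ^ k)]
  have h := integrableOn_rpow_mul_exp_neg_mul_rpow (p := 1) (s := ((2 - k : ℕ) : ℝ)) (b := b)
    (by linarith [(Nat.cast_nonneg (2 - k) : (0:ℝ) ≤ _)]) one_pos hb
  refine h.congr_fun (fun y hy => ?_) measurableSet_Ioi
  have hy : 0 < y := hy
  simp only [finrank_euclideanSpace, Fintype.card_fin, Real.rpow_natCast, Real.rpow_one,
    smul_eq_mul]
  have : y ^ 2 = y ^ (2 - k) * y ^ k := by rw [← pow_add]; congr 1; omega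
  rw [show 3 - 1 = 2 from rfl, this]
  field_simp

/-- The splitting of `ℝ³` into the first coordinate and the remaining two. -/
noncomputable def euclideanFinThreeSplit :
    EuclideanSpace ℝ (Fin 3) ≃ᵐ ℝ × EuclideanSpace ℝ (Fin 2) :=
  ((MeasurableEquiv.toLp 2 (Fin 3 → ℝ)).symm.trans
    (MeasurableEquiv.piFinSuccAbove (fun _ => ℝ) 0)).trans
    ((MeasurableEquiv.refl ℝ).prodCongr (MeasurableEquiv.toLp 2 (Fin 2 → ℝ)))

lemma measurePreserving_euclideanFinThreeSplit : MeasurePreserving euclideanFinThreeSplit := by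
  have h1 : MeasurePreserving (Prod.map id (WithLp.toLp 2) : ℝ × (Fin 2 → ℝ) → _) :=
    (MeasurePreserving.id (volume : Measure ℝ)).prod (PiLp.volume_preserving_toLp (Fin 2))
  exact h1.comp ((volume_preserving_piFinSuccAbove (fun _ : Fin 3 => ℝ) 0).comp
    (PiLp.volume_preserving_ofLp (Fin 3)))

lemma euclideanFinThreeSplit_fst (ξ : EuclideanSpace ℝ (Fin 3)) :
    (euclideanFinThreeSplit ξ).1 = ξ 0 := rfl

lemma norm_eq_euclideanFinThreeSplit (ξ : EuclideanSpace ℝ (Fin 3)) :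
    ‖ξ‖ = √((euclideanFinThreeSplit ξ).1 ^ 2 + ‖(euclideanFinThreeSplit ξ).2‖ ^ 2) := by
  rw [EuclideanSpace.norm_eq, EuclideanSpace.norm_eq, Real.sq_sqrt (by positivity),
    Fin.sum_univ_succ]
  simp only [Real.norm_eq_abs, sq_abs]
  rfl

/-- The Fourier-side kernel `e^{-2πw‖ξ‖} / (2π‖ξ‖)` as a function of `ρ = ‖ξ‖`. -/
noncomputable def poissonProfile (w : ℂ) (ρ : ℝ) : ℂ :=
  Complex.exp (-(2 * Real.pi * w) * ρ) / (2 * Real.pi * ρ)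

lemma norm_poissonProfile (w : ℂ) {ρ : ℝ} (hρ : 0 ≤ ρ) :
    ‖poissonProfile w ρ‖ = (2 * Real.pi)⁻¹ * (Real.exp (-(2 * Real.pi * w.re) * ρ) / ρ ^ 1) := by
  have e : (2 * Real.pi * ρ : ℂ) = ((2 * Real.pi * ρ : ℝ) : ℂ) := by push_cast; ring
  rw [poissonProfile, norm_div, Complex.norm_exp, e, Complex.norm_real,
    Real.norm_of_nonneg (by positivity)]
  simp
  field_simp

lemma measurable_poissonProfile (w : ℂ) : Measurable (poissonProfile w) := by
  unfold poissonProfile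
  fun_prop

lemma integrable_poissonProfile {w : ℂ} (hw : 0 < w.re) :
    Integrable (fun ξ : EuclideanSpace ℝ (Fin 3) => poissonProfile w ‖ξ‖) := by
  refine ((integrable_exp_neg_norm_div_pow (b := 2 * Real.pi * w.re) (by positivity)
    one_le_two).const_mul (2 * Real.pi)⁻¹).mono' ?_ ?_
  · exact ((measurable_poissonProfile w).comp measurable_norm).aestronglyMeasurable
  · exact .of_forall fun ξ => (norm_poissonProfile w (norm_nonneg ξ)).le

lemma integral_mul_poissonProfile_sqrt {w : ℂ} (hw : 0 < w.re) {a : ℝ} (ha : a ≠ 0)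
    (h_int : IntegrableOn (fun b : ℝ => b • poissonProfile w √(a ^ 2 + b ^ 2)) (Set.Ioi 0)) :
    ∫ b in Set.Ioi (0 : ℝ), b • poissonProfile w √(a ^ 2 + b ^ 2) =
      Complex.exp (-(2 * Real.pi * w) * |a|) / (2 * Real.pi) / (2 * Real.pi * w) := by
  have hw0 : w ≠ 0 := by rintro rfl; simp at hw
  have hpi : (Real.pi : ℂ) ≠ 0 := by exact_mod_cast Real.pi_ne_zero
  have hpos : ∀ b : ℝ, 0 < a ^ 2 + b ^ 2 := fun b => by positivity
  have hderiv : ∀ b : ℝ, HasDerivAt (fun b : ℝ =>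
      -(Complex.exp (-(2 * Real.pi * w) * (√(a ^ 2 + b ^ 2) : ℝ)) / (2 * Real.pi) /
        (2 * Real.pi * w)))
      (b • poissonProfile w √(a ^ 2 + b ^ 2)) b := by
    intro b
    have h1 : HasDerivAt (fun b : ℝ => √(a ^ 2 + b ^ 2)) (b / √(a ^ 2 + b ^ 2)) b := by
      have := ((hasDerivAt_pow 2 b).const_add (a ^ 2)).sqrt (hpos b).ne'
      convert this using 1
      simp
      field_simp
    have h2 := ((h1.ofReal_comp.const_mul (-(2 * Real.pi * w))).cexp.div_const
      (2 * Real.pi)).div_const (2 * Real.pi * w) |>.neg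
    refine h2.congr_deriv ?_
    have hs : ((√(a ^ 2 + b ^ 2) : ℝ) : ℂ) ≠ 0 := by
      exact_mod_cast (Real.sqrt_pos.2 (hpos b)).ne'
    simp only [poissonProfile, Complex.real_smul]
    push_cast
    field_simp
  have hlim : Filter.Tendsto (fun b : ℝ =>
      -(Complex.exp (-(2 * Real.pi * w) * (√(a ^ 2 + b ^ 2) : ℝ)) / (2 * Real.pi) /
        (2 * Real.pi * w))) Filter.atTop (nhds (-(0 / (2 * Real.pi) / (2 * Real.pi * w)))) := by
    refine (Filter.Tendsto.div_const (Filter.Tendsto.div_const ?_ _) _).neg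
    rw [tendsto_zero_iff_norm_tendsto_zero]
    have : ∀ b : ℝ, ‖Complex.exp (-(2 * Real.pi * w) * (√(a ^ 2 + b ^ 2) : ℝ))‖ =
        Real.exp (-(2 * Real.pi * w.re * √(a ^ 2 + b ^ 2))) := by
      intro b; rw [Complex.norm_exp]; simp
    simp_rw [this]
    refine Real.tendsto_exp_neg_atTop_nhds_zero.comp
      (Filter.Tendsto.const_mul_atTop (by positivity) ?_)
    refine Filter.tendsto_atTop_mono (fun b => ?_) Filter.tendsto_id
    exact Real.le_sqrt_of_sq_le (by simp; positivity)
  rw [integral_Ioi_of_hasDerivAt_of_tendsto (hderiv 0).continuousAt.continuousWithinAt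
    (fun b _ => hderiv b) h_int hlim]
  simp [Real.sqrt_sq_eq_abs]

lemma integral_exp_mul_exp_neg_abs {w : ℂ} (hw : 0 < w.re) (r : ℝ) :
    ∫ a : ℝ, Complex.exp (-(2 * Real.pi * (a * r)) * Complex.I) *
      Complex.exp (-(2 * Real.pi * w) * |a|) =
      (1 / (w + r * Complex.I) + 1 / (w - r * Complex.I)) / (2 * Real.pi) := by
  have hpi : (Real.pi : ℂ) ≠ 0 := by exact_mod_cast Real.pi_ne_zero
  have h1 : (-(2 * Real.pi * (w + r * Complex.I))).re < 0 := by
    simp; positivity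
  have h2 : 0 < (2 * Real.pi * (w - r * Complex.I)).re := by
    simp; positivity
  have e1 : Set.EqOn (fun a : ℝ => Complex.exp (-(2 * Real.pi * (a * r)) * Complex.I) *
      Complex.exp (-(2 * Real.pi * w) * |a|))
      (fun a : ℝ => Complex.exp (-(2 * Real.pi * (w + r * Complex.I)) * a)) (Set.Ioi 0) := by
    intro a ha
    have ha : 0 < a := ha
    simp only [abs_of_pos ha]
    rw [← Complex.exp_add]; congr 1; ring
  have e2 : Set.EqOn (fun a : ℝ => Complex.exp (-(2 * Real.pi * (a * r)) * Complex.I) *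
      Complex.exp (-(2 * Real.pi * w) * |a|))
      (fun a : ℝ => Complex.exp ((2 * Real.pi * (w - r * Complex.I)) * a)) (Set.Iic 0) := by
    intro a ha
    have ha : a ≤ 0 := ha
    simp only [abs_of_nonpos ha]
    rw [← Complex.exp_add]; congr 1; push_cast; ring
  have i1 := (integrableOn_exp_mul_complex_Ioi h1 0).congr_fun e1.symm measurableSet_Ioi
  have i2 := (integrableOn_exp_mul_complex_Iic h2 0).congr_fun e2.symm measurableSet_Iic
  rw [← intervalIntegral.integral_Iic_add_Ioi i2 i1, setIntegral_congr_fun measurableSet_Ioi e1,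
    setIntegral_congr_fun measurableSet_Iic e2, integral_exp_mul_complex_Ioi h1,
    integral_exp_mul_complex_Iic h2]
  have n1 : w + r * Complex.I ≠ 0 := by
    intro h; have := congrArg Complex.re h; simp at this; linarith
  have n2 : w - r * Complex.I ≠ 0 := by
    intro h; have := congrArg Complex.re h; simp at this; linarith
  simp
  field_simp
  ring

lemma fourier_poissonProfile {w : ℂ} (hw : 0 < w.re) (v : EuclideanSpace ℝ (Fin 3)) :
    𝓕 (fun ξ : EuclideanSpace ℝ (Fin 3) => poissonProfile w ‖ξ‖) v =
      (1 / (w + ‖v‖ * Complex.I) + 1 / (w - ‖v‖ * Complex.I)) / (4 * Real.pi ^ 2 * w) := by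
  set r := ‖v‖ with hr
  set v' : EuclideanSpace ℝ (Fin 3) := EuclideanSpace.single 0 r with hv'
  have hn : ‖v'‖ = ‖v‖ := by simp [hv', hr]
  set R := (ℝ ∙ (v' - v))ᗮ.reflection with hR
  have hRv : R v' = v := Submodule.reflection_sub hn
  set F : ℝ × EuclideanSpace ℝ (Fin 2) → ℂ := fun p =>
    Complex.exp (-(2 * Real.pi * (p.1 * r)) * Complex.I) *
      poissonProfile w √(p.1 ^ 2 + ‖p.2‖ ^ 2) with hF
  have hcomp : ∀ ξ, Complex.exp (((-2 * Real.pi * ⟪R ξ, v⟫_ℝ : ℝ) : ℂ) * Complex.I) •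
      poissonProfile w ‖R ξ‖ = F (euclideanFinThreeSplit ξ) := by
    intro ξ
    have h1 : ⟪R ξ, v⟫_ℝ = ξ 0 * r := by
      conv_lhs => rw [← hRv]
      rw [LinearIsometryEquiv.inner_map_map, hv', EuclideanSpace.inner_single_right]
      simp [mul_comm]
    rw [h1, LinearIsometryEquiv.norm_map, norm_eq_euclideanFinThreeSplit, hF, smul_eq_mul]
    simp only [euclideanFinThreeSplit_fst]
    congr 3
    push_cast
    ring
  rw [Real.fourier_eq', ← R.measurePreserving.integral_comp R.toMeasurableEquiv.measurableEmbedding]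
  simp_rw [hcomp]
  have hFint : Integrable F := by
    rw [← measurePreserving_euclideanFinThreeSplit.integrable_comp_emb
      euclideanFinThreeSplit.measurableEmbedding]
    refine (integrable_poissonProfile hw).mono ?_ (.of_forall fun ξ => ?_)
    · refine Measurable.aestronglyMeasurable (Measurable.comp ?_ euclideanFinThreeSplit.measurable)
      have := measurable_poissonProfile w
      fun_prop
    · rw [Function.comp_apply, ← hcomp, norm_smul, Complex.norm_exp_ofReal_mul_I, one_mul,
        LinearIsometryEquiv.norm_map]
  rw [measurePreserving_euclideanFinThreeSplit.integral_comp
    euclideanFinThreeSplit.measurableEmbedding F, Measure.volume_eq_prod, integral_prod _ hFint]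
  have hslice : ∀ᵐ a : ℝ, ∫ y, F (a, y) = Complex.exp (-(2 * Real.pi * (a * r)) * Complex.I) *
      Complex.exp (-(2 * Real.pi * w) * |a|) / (2 * Real.pi * w) := by
    have hne : ∀ᵐ a : ℝ, a ≠ 0 := by simp [ae_iff]
    filter_upwards [hFint.prod_right_ae, hne] with a ha ha0
    have h_int : Integrable (fun y : EuclideanSpace ℝ (Fin 2) =>
        poissonProfile w √(a ^ 2 + ‖y‖ ^ 2)) := by
      have := ha.const_mul (Complex.exp (-(2 * Real.pi * (a * r)) * Complex.I))⁻¹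
      refine this.congr (.of_forall fun y => ?_)
      simp [hF]
    rw [integrable_fun_norm_addHaar volume (f := fun b => poissonProfile w √(a ^ 2 + b ^ 2))]
      at h_int
    simp only [finrank_euclideanSpace, Fintype.card_fin, Nat.add_one_sub_one, pow_one] at h_int
    simp only [hF]
    rw [integral_const_mul,
      integral_fun_norm_addHaar volume (fun b => poissonProfile w √(a ^ 2 + b ^ 2))]
    simp only [finrank_euclideanSpace, Fintype.card_fin, Nat.add_one_sub_one, pow_one]
    rw [integral_mul_poissonProfile_sqrt hw ha0 h_int, Measure.real,
      EuclideanSpace.volume_ball_fin_two]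
    have hpi : (Real.pi : ℂ) ≠ 0 := by exact_mod_cast Real.pi_ne_zero
    simp [Real.pi_nonneg]
    field_simp
  rw [integral_congr_ae hslice, integral_div, integral_exp_mul_exp_neg_abs hw]
  have hpi : (Real.pi : ℂ) ≠ 0 := by exact_mod_cast Real.pi_ne_zero
  field_simp
  ring

/-- The multiplier `e^{-2πz‖ξ‖} / (2π‖ξ‖)²` as a function of `ρ = ‖ξ‖`. -/
noncomputable def dampedProfile (z : ℂ) (ρ : ℝ) : ℂ :=
  Complex.exp (-(2 * Real.pi * z) * ρ) / (2 * Real.pi * ρ) ^ 2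

lemma integrable_dampedProfile {z : ℂ} (hz : 0 < z.re) :
    Integrable (fun ξ : EuclideanSpace ℝ (Fin 3) => dampedProfile z ‖ξ‖) := by
  refine ((integrable_exp_neg_norm_div_pow (b := 2 * Real.pi * z.re) (by positivity)
    le_rfl).const_mul ((2 * Real.pi) ^ 2)⁻¹).mono' ?_ (.of_forall fun ξ => le_of_eq ?_)
  · unfold dampedProfile
    exact Measurable.aestronglyMeasurable (by fun_prop)
  · have e : ((2 * Real.pi * ‖ξ‖) ^ 2 : ℂ) = (((2 * Real.pi * ‖ξ‖) ^ 2 : ℝ) : ℂ) := by push_cast; ring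
    rw [dampedProfile, norm_div, Complex.norm_exp, e, Complex.norm_real,
      Real.norm_of_nonneg (by positivity)]
    simp
    field_simp

lemma integrableOn_exp_neg_mul_add {β : ℝ} (hβ : 0 < β) (α : ℝ) :
    IntegrableOn (fun τ : ℝ => Real.exp (-(β * (α + τ)))) (Set.Ioi 0) := by
  refine ((integrableOn_exp_mul_Ioi (neg_neg_of_pos hβ) 0).const_mul
    (Real.exp (-(β * α)))).congr (.of_forall fun τ => ?_)
  simp only
  rw [← Real.exp_add]; congr 1; ring

lemma integral_exp_neg_mul_add {β : ℝ} (hβ : 0 < β) (α : ℝ) :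
    ∫ τ in Set.Ioi (0 : ℝ), Real.exp (-(β * (α + τ))) = Real.exp (-(β * α)) / β := by
  have e : ∀ τ : ℝ, Real.exp (-(β * (α + τ))) = Real.exp (-(β * α)) * Real.exp (-β * τ) := by
    intro τ
    rw [← Real.exp_add]; congr 1; ring
  simp_rw [e]
  rw [integral_const_mul, integral_exp_mul_Ioi (neg_neg_of_pos hβ)]
  simp [div_eq_mul_inv]

lemma integral_poissonProfile_add (z : ℂ) {ρ : ℝ} (hρ : 0 < ρ) :
    ∫ τ in Set.Ioi (0 : ℝ), poissonProfile (z + τ) ρ = dampedProfile z ρ := by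
  have e : ∀ τ : ℝ, poissonProfile (z + τ) ρ = Complex.exp (-(2 * Real.pi * z) * ρ) /
      (2 * Real.pi * ρ) * Complex.exp ((-(2 * Real.pi * ρ) : ℂ) * τ) := by
    intro τ
    rw [poissonProfile, div_mul_eq_mul_div, ← Complex.exp_add]; congr 2; ring
  have hpi := Real.pi_pos
  have hre : (-(2 * Real.pi * ρ) : ℂ).re < 0 := by simp; positivity
  simp_rw [e]
  rw [integral_const_mul, integral_exp_mul_complex_Ioi hre, dampedProfile]
  simp
  field_simp

lemma norm_poissonProfile_add (z : ℂ) {ρ : ℝ} (hρ : 0 ≤ ρ) (τ : ℝ) :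
    ‖poissonProfile (z + τ) ρ‖ =
      (2 * Real.pi * ρ)⁻¹ * Real.exp (-((2 * Real.pi * ρ) * (z.re + τ))) := by
  rw [norm_poissonProfile _ hρ]
  simp only [Complex.add_re, Complex.ofReal_re, pow_one, mul_inv]
  rw [div_eq_inv_mul, ← mul_assoc]
  congr 2
  ring

lemma integrable_poissonProfile_prod {z : ℂ} (hz : 0 < z.re) :
    Integrable (fun p : EuclideanSpace ℝ (Fin 3) × ℝ => poissonProfile (z + p.2) ‖p.1‖)
      (volume.prod (volume.restrict (Set.Ioi 0))) := by
  have hne : ∀ᵐ ξ : EuclideanSpace ℝ (Fin 3), ξ ≠ 0 := by simp [ae_iff]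
  have hmeas : Measurable
      (fun p : EuclideanSpace ℝ (Fin 3) × ℝ => poissonProfile (z + p.2) ‖p.1‖) := by
    unfold poissonProfile
    fun_prop
  rw [integrable_prod_iff hmeas.aestronglyMeasurable]
  constructor
  · filter_upwards [hne] with ξ hξ
    have hρ : 0 < ‖ξ‖ := norm_pos_iff.2 hξ
    refine ((integrableOn_exp_neg_mul_add (β := 2 * Real.pi * ‖ξ‖) (by positivity) z.re).const_mul
      (2 * Real.pi * ‖ξ‖)⁻¹).mono' (hmeas.comp measurable_prodMk_left).aestronglyMeasurable
      (.of_forall fun τ => (norm_poissonProfile_add z hρ.le τ).le)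
  · refine ((integrable_exp_neg_norm_div_pow (b := 2 * Real.pi * z.re) (by positivity)
      le_rfl).const_mul ((2 * Real.pi) ^ 2)⁻¹).congr ?_
    filter_upwards [hne] with ξ hξ
    have hρ : 0 < ‖ξ‖ := norm_pos_iff.2 hξ
    simp_rw [norm_poissonProfile_add z hρ.le]
    rw [integral_const_mul, integral_exp_neg_mul_add (by positivity)]
    have : -(2 * Real.pi * ‖ξ‖ * z.re) = -(2 * Real.pi * z.re) * ‖ξ‖ := by ring
    rw [this]
    field_simp

lemma tendsto_log_sub_log {z : ℂ} (hz : 0 < z.re) {r : ℝ} (hr : 0 ≤ r) :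
    Filter.Tendsto (fun τ : ℝ => Complex.log (z + τ + r * Complex.I) -
      Complex.log (z + τ - r * Complex.I)) Filter.atTop (nhds 0) := by
  have h1 : Filter.Tendsto (fun τ : ℝ => 2 * r / (z.re + τ)) Filter.atTop (nhds 0) :=
    (Filter.tendsto_atTop_add_const_left _ _ Filter.tendsto_id).const_div_atTop _
  refine squeeze_zero_norm' ?_ h1
  filter_upwards [Filter.eventually_ge_atTop 0] with τ hτ
  refine norm_log_sub_log_le (by simp; positivity) hr (by positivity) fun σ _ => ?_
  refine le_trans (le_of_eq ?_) (Complex.re_le_norm _)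
  simp

lemma fourier_dampedProfile {z : ℂ} (hz : 0 < z.re) {v : EuclideanSpace ℝ (Fin 3)} (hv : v ≠ 0) :
    𝓕 (fun ξ : EuclideanSpace ℝ (Fin 3) => dampedProfile z ‖ξ‖) v =
      (Complex.log (z + ‖v‖ * Complex.I) - Complex.log (z - ‖v‖ * Complex.I)) /
        (4 * Real.pi ^ 2 * Complex.I * ‖v‖) := by
  have hr : 0 < ‖v‖ := norm_pos_iff.2 hv
  have hne : ∀ᵐ ξ : EuclideanSpace ℝ (Fin 3), ξ ≠ 0 := by simp [ae_iff]
  set G : EuclideanSpace ℝ (Fin 3) → ℝ → ℂ := fun ξ τ =>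
    Complex.exp (((-2 * Real.pi * ⟪ξ, v⟫_ℝ : ℝ) : ℂ) * Complex.I) • poissonProfile (z + τ) ‖ξ‖
    with hG
  have hGint : Integrable (Function.uncurry G) (volume.prod (volume.restrict (Set.Ioi 0))) := by
    refine (integrable_poissonProfile_prod hz).mono ?_ (.of_forall fun p => ?_)
    · have hc : Continuous fun p : EuclideanSpace ℝ (Fin 3) × ℝ =>
          Complex.exp (((-2 * Real.pi * ⟪p.1, v⟫_ℝ : ℝ) : ℂ) * Complex.I) := by fun_prop
      exact hc.aestronglyMeasurable.smul (integrable_poissonProfile_prod hz).1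
    · rw [Function.uncurry, hG]
      simp only
      rw [norm_smul, Complex.norm_exp_ofReal_mul_I, one_mul]
  have h1 : 𝓕 (fun ξ : EuclideanSpace ℝ (Fin 3) => dampedProfile z ‖ξ‖) v =
      ∫ ξ, ∫ τ in Set.Ioi (0 : ℝ), G ξ τ := by
    rw [Real.fourier_eq']
    refine integral_congr_ae ?_
    filter_upwards [hne] with ξ hξ
    rw [hG]
    simp only
    rw [integral_smul, integral_poissonProfile_add z (norm_pos_iff.2 hξ)]
  have h2 : ∀ τ : ℝ, 0 < τ → ∫ ξ, G ξ τ =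
      (1 / (z + τ + ‖v‖ * Complex.I) + 1 / (z + τ - ‖v‖ * Complex.I)) /
        (4 * Real.pi ^ 2 * (z + τ)) := by
    intro τ hτ
    rw [← fourier_poissonProfile (w := z + τ) (by simp; positivity), Real.fourier_eq']
  rw [h1, integral_integral_swap hGint]
  have h_int := hGint.integral_prod_right
  have hderiv : ∀ τ : ℝ, 0 ≤ τ → HasDerivAt (fun τ : ℝ => -((Complex.log (z + τ + ‖v‖ * Complex.I) -
      Complex.log (z + τ - ‖v‖ * Complex.I)) / (4 * Real.pi ^ 2 * Complex.I * ‖v‖)))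
      ((1 / (z + τ + ‖v‖ * Complex.I) + 1 / (z + τ - ‖v‖ * Complex.I)) /
        (4 * Real.pi ^ 2 * (z + τ))) τ := by
    intro τ hτ
    have hzτ : 0 < z.re + τ := by positivity
    have h0 : HasDerivAt (fun τ : ℝ => z + τ) 1 τ := by
      simpa using (Complex.ofRealCLM.hasDerivAt (x := τ)).const_add z
    have hp := (h0.add_const (‖v‖ * Complex.I)).clog_real (Or.inl (by simpa using hzτ))
    have hm := (h0.sub_const (‖v‖ * Complex.I)).clog_real (Or.inl (by simpa using hzτ))
    refine ((hp.sub hm).div_const (4 * Real.pi ^ 2 * Complex.I * ‖v‖)).neg.congr_deriv ?_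
    have n0 : z + τ ≠ 0 := by
      intro h; have := congrArg Complex.re h; simp at this; linarith
    have n1 : z + τ + ‖v‖ * Complex.I ≠ 0 := by
      intro h; have := congrArg Complex.re h; simp at this; linarith
    have n2 : z + τ - ‖v‖ * Complex.I ≠ 0 := by
      intro h; have := congrArg Complex.re h; simp at this; linarith
    have n3 : (‖v‖ : ℂ) ≠ 0 := by exact_mod_cast hr.ne'
    have n4 : (Real.pi : ℂ) ≠ 0 := by exact_mod_cast Real.pi_ne_zero
    field_simp
    ring
  have hlim := ((tendsto_log_sub_log hz hr.le).div_const (4 * Real.pi ^ 2 * Complex.I * ‖v‖)).neg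
  rw [setIntegral_congr_fun measurableSet_Ioi (fun τ hτ => h2 τ hτ),
    integral_Ioi_of_hasDerivAt_of_tendsto (hderiv 0 le_rfl).continuousAt.continuousWithinAt
      (fun τ hτ => hderiv τ (le_of_lt hτ)) ?_ hlim]
  · simp
  · exact IntegrableOn.congr_fun h_int (fun τ hτ => h2 τ hτ) measurableSet_Ioi

lemma fourier_exp_inner_mul (h : EuclideanSpace ℝ (Fin 3) → ℂ) (x y : EuclideanSpace ℝ (Fin 3)) :
    𝓕 (fun ξ => Complex.exp (2 * Real.pi * Complex.I * ((⟪x, ξ⟫_ℝ : ℝ) : ℂ)) * h ξ) y =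
      𝓕 h (y - x) := by
  rw [Real.fourier_eq', Real.fourier_eq']
  refine integral_congr_ae (.of_forall fun ξ => ?_)
  simp only [smul_eq_mul]
  rw [← mul_assoc, ← Complex.exp_add, inner_sub_right, real_inner_comm x ξ]
  congr 2
  push_cast
  ring

lemma integral_exp_mul_fourier_eq {h g : EuclideanSpace ℝ (Fin 3) → ℂ} (hh : Integrable h)
    (hg : Integrable g) (x : EuclideanSpace ℝ (Fin 3)) :
    ∫ ξ, Complex.exp (2 * Real.pi * Complex.I * ((⟪x, ξ⟫_ℝ : ℝ) : ℂ)) * h ξ * 𝓕 g ξ =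
      ∫ y, 𝓕 h (y - x) * g y := by
  have hex : Integrable (fun ξ : EuclideanSpace ℝ (Fin 3) =>
      Complex.exp (2 * Real.pi * Complex.I * ((⟪x, ξ⟫_ℝ : ℝ) : ℂ)) * h ξ) := by
    refine hh.bdd_mul (c := 1) (Continuous.aestronglyMeasurable (by fun_prop))
      (.of_forall fun ξ => ?_)
    rw [Complex.norm_exp]
    simp
  have := VectorFourier.integral_fourierIntegral_smul_eq_flip (μ := volume) (ν := volume)
    (L := innerₗ (EuclideanSpace ℝ (Fin 3))) Real.continuous_fourierChar
    (by exact continuous_inner) hex hg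
  rw [flip_innerₗ] at this
  simp_rw [← fourier_exp_inner_mul]
  exact this.symm

lemma integrable_fourier_sub_mul {h g : EuclideanSpace ℝ (Fin 3) → ℂ} (hh : Integrable h)
    (hg : Integrable g) (x : EuclideanSpace ℝ (Fin 3)) :
    Integrable (fun y => 𝓕 h (y - x) * g y) := by
  have hc : Continuous (𝓕 h) := VectorFourier.fourierIntegral_continuous
    Real.continuous_fourierChar (by exact continuous_inner) hh
  exact hg.bdd_mul (c := ∫ ξ, ‖h ξ‖) (hc.comp (by fun_prop)).aestronglyMeasurable
    (.of_forall fun y => VectorFourier.norm_fourierIntegral_le_integral_norm _ _ _ _ _)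

lemma exists_lintegral_mul_rpow_sub_le {ψ : ℝ → ℝ} (hψ : Integrable ψ) (hψ1 : ∀ w, ψ w ≤ 1) :
    ∃ A : ℝ≥0∞, A < ⊤ ∧ ∀ c : ℝ,
      ∫⁻ w, ENNReal.ofReal (ψ w) * ENNReal.ofReal |w - c| ^ (-1 / 2 : ℝ) ≤ A := by
  set N : ℝ → ℝ := fun u => if |u| < 1 then |u| ^ (-1 / 2 : ℝ) else 0 with hN
  have hNint : Integrable N := by
    have h := (integrable_fun_norm_addHaar (volume : Measure ℝ)
      (f := fun y : ℝ => if y < 1 then y ^ (-1 / 2 : ℝ) else 0)).2 ?_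
    · exact h
    · simp only [Module.finrank_self, Nat.sub_self, pow_zero, one_smul]
      have h1 : IntegrableOn (fun y : ℝ => y ^ (-1 / 2 : ℝ)) (Set.Ioo 0 1) :=
        (intervalIntegral.integrableOn_Ioo_rpow_iff one_pos).2 (by norm_num)
      have h2 : Set.Ioo (0 : ℝ) 1 = Set.Iio 1 ∩ Set.Ioi 0 := by
        rw [Set.inter_comm, Set.Ioi_inter_Iio]
      have h3 := (integrable_indicator_iff measurableSet_Ioo).2 h1
      rw [h2, Set.inter_comm, ← Set.indicator_indicator,
        integrable_indicator_iff measurableSet_Ioi] at h3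
      exact h3
  refine ⟨(∫⁻ w, ENNReal.ofReal (ψ w)) + ∫⁻ w, ENNReal.ofReal (N w), ?_, fun c => ?_⟩
  · exact ENNReal.add_lt_top.2 ⟨hψ.lintegral_lt_top, hNint.lintegral_lt_top⟩
  have hNm : Measurable fun w : ℝ => ENNReal.ofReal (N w) := by
    refine Measurable.ennreal_ofReal (Measurable.ite ?_ (by fun_prop) measurable_const)
    exact measurableSet_lt (by fun_prop) measurable_const
  have hNc : Measurable fun w : ℝ => ENNReal.ofReal (N (w - c)) :=
    hNm.comp (measurable_id.sub_const c)
  rw [← lintegral_sub_right_eq_self (fun w => ENNReal.ofReal (N w)) c,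
    ← lintegral_add_right _ hNc]
  refine lintegral_mono_ae ?_
  have hne : ∀ᵐ w : ℝ, w ≠ c := by simp [ae_iff]
  filter_upwards [hne] with w hw
  have h0 : 0 < |w - c| := abs_pos.2 (sub_ne_zero.2 hw)
  rw [ENNReal.ofReal_rpow_of_pos h0]
  by_cases h : |w - c| < 1
  · refine le_add_of_nonneg_of_le zero_le ?_
    simp only [hN, if_pos h]
    calc _ ≤ 1 * ENNReal.ofReal (|w - c| ^ (-1 / 2 : ℝ)) := by
          gcongr
          exact ENNReal.ofReal_le_one.2 (hψ1 w)
      _ = _ := one_mul _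
  · refine le_add_of_le_of_nonneg ?_ zero_le
    push Not at h
    calc _ ≤ ENNReal.ofReal (ψ w) * 1 := by
          gcongr
          exact ENNReal.ofReal_le_one.2 (Real.rpow_le_one_of_one_le_of_nonpos h (by norm_num))
      _ = _ := mul_one _

lemma exists_lintegral_prod_mul_rpow_sub_le {ψ : ℝ → ℝ} (hψ : Integrable ψ) (hψm : Measurable ψ)
    (hψ0 : ∀ w, 0 ≤ ψ w) (hψ1 : ∀ w, ψ w ≤ 1) :
    ∃ A : ℝ≥0∞, A < ⊤ ∧ ∀ (i : Fin 3) (σ : (Fin 2 → ℝ) → ℝ), Measurable σ →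
      ∫⁻ y : EuclideanSpace ℝ (Fin 3), ENNReal.ofReal (∏ j, ψ (y j)) *
        ENNReal.ofReal |y i - σ (fun j => y (i.succAbove j))| ^ (-1 / 2 : ℝ) ≤ A := by
  obtain ⟨A, hA, hAle⟩ := exists_lintegral_mul_rpow_sub_le hψ hψ1
  have hprod : Integrable (fun z : Fin 2 → ℝ => ∏ j, ψ (z j)) :=
    Integrable.fintype_prod (f := fun _ => ψ) (fun _ => hψ)
  refine ⟨A * ∫⁻ z : Fin 2 → ℝ, ENNReal.ofReal (∏ j, ψ (z j)),
    ENNReal.mul_lt_top hA hprod.lintegral_lt_top, fun i σ hσ => ?_⟩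
  set F : ℝ × (Fin 2 → ℝ) → ℝ≥0∞ := fun p => ENNReal.ofReal (ψ p.1 * ∏ j, ψ (p.2 j)) *
    ENNReal.ofReal |p.1 - σ p.2| ^ (-1 / 2 : ℝ) with hF
  have hFm : Measurable F := by
    have : Measurable fun z : Fin 2 → ℝ => ∏ j, ψ (z j) :=
      Finset.measurable_prod _ fun j _ => hψm.comp (measurable_pi_apply j)
    fun_prop
  have hmp := (volume_preserving_piFinSuccAbove (fun _ : Fin 3 => ℝ) i).comp
    (PiLp.volume_preserving_ofLp (Fin 3))
  have h1 : ∫⁻ y : EuclideanSpace ℝ (Fin 3), ENNReal.ofReal (∏ j, ψ (y j)) *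
        ENNReal.ofReal |y i - σ (fun j => y (i.succAbove j))| ^ (-1 / 2 : ℝ) = ∫⁻ p, F p := by
    rw [← hmp.lintegral_comp hFm]
    refine lintegral_congr fun y => ?_
    rw [Fin.prod_univ_succAbove _ i]
    rfl
  rw [h1, Measure.volume_eq_prod, lintegral_prod_symm _ hFm.aemeasurable,
    ← lintegral_const_mul' _ _ hA.ne]
  refine lintegral_mono fun z => ?_
  calc ∫⁻ w, F (w, z) = ∫⁻ w, ENNReal.ofReal (∏ j, ψ (z j)) *
        (ENNReal.ofReal (ψ w) * ENNReal.ofReal |w - σ z| ^ (-1 / 2 : ℝ)) := by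
        refine lintegral_congr fun w => ?_
        simp only [hF]
        rw [ENNReal.ofReal_mul (hψ0 w)]
        ring
    _ = ENNReal.ofReal (∏ j, ψ (z j)) *
        ∫⁻ w, ENNReal.ofReal (ψ w) * ENNReal.ofReal |w - σ z| ^ (-1 / 2 : ℝ) :=
        lintegral_const_mul' _ _ ENNReal.ofReal_ne_top
    _ ≤ ENNReal.ofReal (∏ j, ψ (z j)) * A := by gcongr; exact hAle _
    _ = _ := mul_comm _ _

lemma abs_abs_sub_sqrt_le {r t u B : ℝ} (hr : 0 ≤ r) (ht : 0 ≤ t) (hB : 0 ≤ B)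
    (hru : r ^ 2 = u ^ 2 + B) (hu : r ^ 2 ≤ 3 * u ^ 2) :
    |(|u| - √(t ^ 2 - B))| ≤ 4 * |r - t| := by
  have hu0 := abs_nonneg u
  have hr2 : r ≤ 2 * |u| := by
    refine abs_le_of_sq_le_sq' ?_ (by positivity) |>.2
    rw [mul_pow, sq_abs]; linarith [sq_nonneg u]
  rcases le_or_gt B (t ^ 2) with h | h
  · set τ := √(t ^ 2 - B) with hτ
    have hτ0 : 0 ≤ τ := Real.sqrt_nonneg _
    have hτ2 : τ ^ 2 = t ^ 2 - B := Real.sq_sqrt (by linarith)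
    have ht2 : t ≤ 2 * (|u| + τ) := by
      refine abs_le_of_sq_le_sq' ?_ (by positivity) |>.2
      have := sq_abs u
      nlinarith [mul_nonneg hu0 hτ0]
    have hmul : |(|u| - τ)| * (|u| + τ) = |r - t| * (r + t) := by
      have e1 := abs_mul (|u| - τ) (|u| + τ)
      have e2 := abs_mul (r - t) (r + t)
      rw [abs_of_nonneg (add_nonneg hu0 hτ0)] at e1
      rw [abs_of_nonneg (add_nonneg hr ht)] at e2
      rw [← e1, ← e2]
      congr 1
      linear_combination sq_abs u - hτ2 - hru
    rcases (by positivity : 0 ≤ |u| + τ).eq_or_lt with h0 | h0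
    · have e1 : |u| = 0 := by linarith
      have e2 : τ = 0 := by linarith
      rw [e1, e2]; simp
    · refine le_of_mul_le_mul_right ?_ h0
      rw [hmul]
      have : |r - t| * (r + t) ≤ |r - t| * (4 * (|u| + τ)) := by
        gcongr; linarith
      linarith
  · rw [Real.sqrt_eq_zero_of_nonpos (by linarith), sub_zero, abs_abs]
    have htr : t < r := by
      refine lt_of_pow_lt_pow_left₀ 2 hr ?_
      linarith [sq_nonneg u]
    rw [abs_of_pos (sub_pos.2 htr)]
    rcases hu0.eq_or_lt with h0 | h0
    · rw [← h0]; linarith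
    refine le_of_mul_le_mul_right ?_ h0
    have h1 := sq_abs u
    nlinarith [mul_nonneg (sub_pos.2 htr).le (by linarith : 0 ≤ 4 * |u| - (r + t))]

lemma exists_abs_apply_sub_le (x y : EuclideanSpace ℝ (Fin 3)) {t : ℝ} (ht : 0 ≤ t) :
    ∃ (i : Fin 3) (ς : Bool), |y i - (x i + (if ς then 1 else -1) *
      √(t ^ 2 - ∑ j, (y (i.succAbove j) - x (i.succAbove j)) ^ 2))| ≤ 4 * |‖y - x‖ - t| := by
  have hsq : ‖y - x‖ ^ 2 = ∑ j, (y j - x j) ^ 2 := by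
    rw [EuclideanSpace.norm_sq_eq]; simp
  obtain ⟨i, hi⟩ : ∃ i : Fin 3, ‖y - x‖ ^ 2 ≤ 3 * (y i - x i) ^ 2 := by
    by_contra! h
    rw [Fin.sum_univ_three] at hsq
    linarith [h 0, h 1, h 2]
  have hb := abs_abs_sub_sqrt_le (norm_nonneg (y - x)) ht
    (Finset.sum_nonneg fun j _ => sq_nonneg (y (i.succAbove j) - x (i.succAbove j)))
    (by rw [hsq, Fin.sum_univ_succAbove _ i]) hi
  rcases abs_cases (y i - x i) with ⟨h, _⟩ | ⟨h, _⟩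
  · refine ⟨i, true, le_trans (le_of_eq ?_) hb⟩
    rw [h]; congr 1; simp; ring
  · refine ⟨i, false, le_trans (le_of_eq ?_) hb⟩
    rw [h, ← abs_neg]; congr 1; simp; ring

lemma exists_lintegral_weight_le {s : ℝ} (hs : 3 / 2 < s) :
    ∃ A : ℝ≥0∞, A < ⊤ ∧ ∀ (x : EuclideanSpace ℝ (Fin 3)) (t : ℝ), 0 ≤ t →
      ∫⁻ y : EuclideanSpace ℝ (Fin 3), ENNReal.ofReal ((1 + ‖y‖ ^ 2) ^ (-s)) *
        (1 + ENNReal.ofReal |‖y - x‖ - t| ^ (-1 / 2 : ℝ)) ≤ A := by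
  set ψ : ℝ → ℝ := fun w => (1 + w ^ 2) ^ (-(s / 3)) with hψdef
  have hψ : Integrable ψ := by
    have := integrable_rpow_neg_one_add_norm_sq (E := ℝ) (μ := volume) (r := 2 * s / 3)
      (by simp; linarith)
    refine this.congr (.of_forall fun w => ?_)
    simp only [hψdef, Real.norm_eq_abs, sq_abs]
    congr 1; ring
  have hψm : Measurable ψ := by fun_prop
  have hψ0 : ∀ w, 0 ≤ ψ w := fun w => by positivity
  have hψ1 : ∀ w, ψ w ≤ 1 := fun w =>
    Real.rpow_le_one_of_one_le_of_nonpos (by linarith [sq_nonneg w]) (by linarith)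
  obtain ⟨A, hA, hAle⟩ := exists_lintegral_prod_mul_rpow_sub_le hψ hψm hψ0 hψ1
  have hwint : Integrable (fun y : EuclideanSpace ℝ (Fin 3) => (1 + ‖y‖ ^ 2) ^ (-s)) := by
    have := integrable_rpow_neg_one_add_norm_sq (E := EuclideanSpace ℝ (Fin 3)) (μ := volume)
      (r := 2 * s) (by simp; linarith)
    refine this.congr (.of_forall fun w => ?_)
    simp only
    congr 1; ring
  have hle : ∀ y : EuclideanSpace ℝ (Fin 3), (1 + ‖y‖ ^ 2) ^ (-s) ≤ ∏ j, ψ (y j) := by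
    intro y
    have h1 : (1 + ‖y‖ ^ 2) ^ (-s) = ∏ _j : Fin 3, (1 + ‖y‖ ^ 2) ^ (-(s / 3)) := by
      rw [Finset.prod_const, ← Real.rpow_mul_natCast (by positivity)]
      congr 1
      simp
    rw [h1]
    refine Finset.prod_le_prod (fun j _ => by positivity) fun j _ => ?_
    refine Real.rpow_le_rpow_of_nonpos (by positivity) ?_ (by linarith)
    have := PiLp.norm_apply_le y j
    rw [← sq_abs (y j), ← Real.norm_eq_abs]
    gcongr
  refine ⟨(∫⁻ y : EuclideanSpace ℝ (Fin 3), ENNReal.ofReal ((1 + ‖y‖ ^ 2) ^ (-s))) +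
    ∑ _i : Fin 3, ∑ _ς : Bool, 2 * A, ?_, fun x t ht => ?_⟩
  · refine ENNReal.add_lt_top.2 ⟨hwint.lintegral_lt_top, ?_⟩
    simp only [ENNReal.sum_lt_top]
    exact fun _ _ _ _ => ENNReal.mul_lt_top (by simp) hA
  set S : Fin 3 → Bool → (Fin 2 → ℝ) → ℝ := fun i ς z => x i + (if ς then 1 else -1) *
      √(t ^ 2 - ∑ j, (z j - x (i.succAbove j)) ^ 2) with hS
  have hSm : ∀ i ς, Measurable (S i ς) := fun i ς => by
    simp only [hS]; fun_prop
  set Φ : Fin 3 → Bool → EuclideanSpace ℝ (Fin 3) → ℝ≥0∞ := fun i ς y =>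
    2 * (ENNReal.ofReal (∏ j, ψ (y j)) *
        ENNReal.ofReal |y i - S i ς (fun j => y (i.succAbove j))| ^ (-1 / 2 : ℝ)) with hΦ
  have hΦm : ∀ i ς, Measurable (Φ i ς) := fun i ς => by
    have h1 : Measurable fun y : EuclideanSpace ℝ (Fin 3) => ∏ j, ψ (y j) :=
      Finset.measurable_prod _ fun j _ => hψm.comp (by fun_prop)
    have h2 : Measurable fun y : EuclideanSpace ℝ (Fin 3) => S i ς (fun j => y (i.succAbove j)) :=
      (hSm i ς).comp (by fun_prop)
    simp only [hΦ]
    fun_prop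
  calc _ ≤ ∫⁻ y : EuclideanSpace ℝ (Fin 3), (ENNReal.ofReal ((1 + ‖y‖ ^ 2) ^ (-s)) +
        ∑ i, ∑ ς, Φ i ς y) := by
        refine lintegral_mono fun y => ?_
        simp only
        rw [mul_add, mul_one]
        gcongr
        obtain ⟨i, ς, h⟩ := exists_abs_apply_sub_le x y ht
        have h1 : ENNReal.ofReal |‖y - x‖ - t| ^ (-1 / 2 : ℝ) ≤
            2 * ENNReal.ofReal |y i - S i ς (fun j => y (i.succAbove j))| ^ (-1 / 2 : ℝ) := by
          have h2 : ENNReal.ofReal |y i - S i ς (fun j => y (i.succAbove j))| ≤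
              4 * ENNReal.ofReal |‖y - x‖ - t| := by
            refine (ENNReal.ofReal_le_ofReal h).trans (le_of_eq ?_)
            rw [ENNReal.ofReal_mul (by norm_num)]; simp
          have h3 := ENNReal.inv_le_inv.2 (ENNReal.rpow_le_rpow h2 (by norm_num : (0 : ℝ) ≤ 1 / 2))
          rw [← ENNReal.rpow_neg, ← ENNReal.rpow_neg, ← neg_div] at h3
          rw [ENNReal.mul_rpow_of_ne_top (by simp) ENNReal.ofReal_ne_top] at h3
          have h4 : (2 : ℝ≥0∞) * (4 : ℝ≥0∞) ^ (-1 / 2 : ℝ) = 1 := by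
            have : (4 : ℝ≥0∞) = 2 ^ (2 : ℝ) := by norm_num
            rw [this, ← ENNReal.rpow_mul]
            norm_num
            rw [ENNReal.rpow_neg_one, ENNReal.mul_inv_cancel (by simp) (by simp)]
          calc _ = 2 * (4 : ℝ≥0∞) ^ (-1 / 2 : ℝ) * ENNReal.ofReal |‖y - x‖ - t| ^ (-1 / 2 : ℝ) := by
                rw [h4, one_mul]
            _ ≤ _ := by
                rw [mul_assoc]; gcongr
        calc _ ≤ ENNReal.ofReal (∏ j, ψ (y j)) *
              (2 * ENNReal.ofReal |y i - S i ς (fun j => y (i.succAbove j))| ^ (-1 / 2 : ℝ)) := by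
              gcongr
              exact hle y
          _ = Φ i ς y := by simp only [hΦ]; ring
          _ ≤ ∑ ς, Φ i ς y :=
            Finset.single_le_sum (f := fun ς => Φ i ς y) (fun _ _ => zero_le) (Finset.mem_univ ς)
          _ ≤ _ := Finset.single_le_sum (f := fun i => ∑ ς, Φ i ς y) (fun _ _ => zero_le)
            (Finset.mem_univ i)
    _ = (∫⁻ y : EuclideanSpace ℝ (Fin 3), ENNReal.ofReal ((1 + ‖y‖ ^ 2) ^ (-s))) +
        ∑ i, ∑ ς, ∫⁻ y, Φ i ς y := by
        rw [lintegral_add_left (by fun_prop), lintegral_finsetSum]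
        · congr 1
          refine Finset.sum_congr rfl fun i _ => ?_
          rw [lintegral_finsetSum _ fun ς _ => hΦm i ς]
        · exact fun i _ => Finset.measurable_sum _ fun ς _ => hΦm i ς
    _ ≤ _ := by
        gcongr with i _ ς _
        simp only [hΦ]
        rw [lintegral_const_mul' _ _ (by simp)]
        gcongr
        exact hAle i _ (hSm i ς)

lemma sq_log_add_log_le {δ : ℝ} (hδ : 0 < δ) {η q : ℝ} (hη : 0 ≤ η) (hq : 0 < q) :
    (40 + Real.log (1 + η) + Real.log (1 + 1 / q)) ^ 2 ≤
      (3 * (1616 + 2 ^ δ / δ ^ 2)) * (1 + η ^ 2) ^ δ * (1 + q ^ (-1 / 2 : ℝ)) := by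
  set a := Real.log (1 + η)
  set b := Real.log (1 + 1 / q)
  have ha0 : 0 ≤ a := Real.log_nonneg (by linarith)
  have hb0 : 0 ≤ b := Real.log_nonneg (by
    have : 0 < 1 / q := by positivity
    linarith)
  have ha : a ^ 2 ≤ 2 ^ δ / δ ^ 2 * (1 + η ^ 2) ^ δ := by
    have h1 : a ≤ (1 + η) ^ δ / δ := Real.log_le_rpow_div (by positivity) hδ
    calc a ^ 2 ≤ ((1 + η) ^ δ / δ) ^ 2 := by gcongr
      _ = ((1 + η) ^ 2) ^ δ / δ ^ 2 := by
        rw [div_pow, ← Real.rpow_natCast, ← Real.rpow_natCast (1 + η), ← Real.rpow_mul (by positivity),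
          ← Real.rpow_mul (by positivity), mul_comm]
      _ ≤ (2 * (1 + η ^ 2)) ^ δ / δ ^ 2 := by
        gcongr
        nlinarith [sq_nonneg (1 - η)]
      _ = _ := by
        rw [Real.mul_rpow (by norm_num) (by positivity)]; ring
  have hb : b ^ 2 ≤ 16 * (1 + q ^ (-1 / 2 : ℝ)) := by
    have h1 : b ≤ (1 + 1 / q) ^ (1 / 4 : ℝ) / (1 / 4) :=
      Real.log_le_rpow_div (by positivity) (by norm_num)
    calc b ^ 2 ≤ ((1 + 1 / q) ^ (1 / 4 : ℝ) / (1 / 4)) ^ 2 := by gcongr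
      _ = 16 * (1 + 1 / q) ^ (1 / 2 : ℝ) := by
        rw [div_pow, ← Real.rpow_natCast, ← Real.rpow_mul (by positivity)]
        norm_num
        ring
      _ ≤ 16 * (1 ^ (1 / 2 : ℝ) + (1 / q) ^ (1 / 2 : ℝ)) := by
        gcongr
        exact Real.rpow_add_le_add_rpow (by norm_num) (by positivity) (by norm_num) (by norm_num)
      _ = _ := by
        rw [Real.one_rpow, one_div, Real.inv_rpow hq.le, ← Real.rpow_neg hq.le]
        norm_num
  have hW : 1 ≤ (1 + η ^ 2) ^ δ := Real.one_le_rpow (by linarith [sq_nonneg η]) hδ.le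
  have hP : 0 ≤ q ^ (-1 / 2 : ℝ) := by positivity
  have hD : 0 ≤ 2 ^ δ / δ ^ 2 := by positivity
  set W := (1 + η ^ 2) ^ δ
  set P := q ^ (-1 / 2 : ℝ)
  set D := 2 ^ δ / δ ^ 2
  have h3 : (40 + a + b) ^ 2 ≤ 3 * (1600 + a ^ 2 + b ^ 2) := by
    nlinarith [sq_nonneg (a - b), sq_nonneg (40 - a), sq_nonneg (40 - b)]
  have h4 : 1600 + a ^ 2 + b ^ 2 ≤ 1600 + D * W + 16 * (1 + P) := by linarith
  have h5 : 1600 + D * W + 16 * (1 + P) ≤ (1616 + D) * W * (1 + P) := by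
    have e1 : 1 ≤ W * (1 + P) := by nlinarith
    have e2 : 1 + P ≤ W * (1 + P) := by nlinarith
    have e3 : D * W ≤ D * W * (1 + P) := by
      have : 0 ≤ D * W * P := by positivity
      linarith
    linarith
  linarith

lemma exists_schwartzMap_lambdaPow_two (f : SchwartzMap (EuclideanSpace ℝ (Fin 3)) ℂ) :
    ∃ g : SchwartzMap (EuclideanSpace ℝ (Fin 3)) ℂ, lambdaPow 2 ⇑f = ⇑g ∧
      ∀ ξ, 𝓕 (⇑g) ξ = (2 * Real.pi * ‖ξ‖) ^ 2 * 𝓕 (⇑f) ξ := by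
  set m : EuclideanSpace ℝ (Fin 3) → ℝ := fun ξ => (2 * Real.pi) ^ 2 * ‖ξ‖ ^ 2 with hm
  have hmt : m.HasTemperateGrowth :=
    (Function.HasTemperateGrowth.const _).mul (Function.hasTemperateGrowth_norm_sq _)
  set G := SchwartzMap.smulLeftCLM ℂ m (𝓕 f) with hG
  have hGξ : ∀ ξ, G ξ = (2 * Real.pi * ‖ξ‖) ^ 2 * 𝓕 (⇑f) ξ := fun ξ => by
    rw [hG, SchwartzMap.smulLeftCLM_apply_apply hmt, SchwartzMap.fourier_coe, Complex.real_smul]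
    simp only [hm]
    push_cast
    ring
  refine ⟨𝓕⁻ G, ?_, fun ξ => ?_⟩
  · ext x
    rw [SchwartzMap.fourierInv_coe, Real.fourierInv_eq', lambdaPow]
    refine integral_congr_ae (.of_forall fun ξ => ?_)
    simp only [smul_eq_mul, hGξ]
    rw [mul_assoc, real_inner_comm ξ x]
    congr 1
    · congr 1
      push_cast
      ring
    · norm_num
  · rw [← hGξ, ← SchwartzMap.fourier_coe, FourierTransform.fourier_fourierInv_eq]

lemma sq_norm_fourier_dampedProfile_add_le {δ : ℝ} (hδ : 0 < δ) {t ε : ℝ} (ht : 0 < t)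
    (hε : 0 < ε) (hε1 : ε ≤ 1) (hεt : ε ≤ t) {x y : EuclideanSpace ℝ (Fin 3)} (hxy : y ≠ x)
    (hq : ‖y - x‖ ≠ t) :
    ‖𝓕 (fun ξ : EuclideanSpace ℝ (Fin 3) => dampedProfile (ε - t * Complex.I) ‖ξ‖) (y - x) +
      (Real.log (1 + t / (1 + |‖x‖ - t|)) : ℝ) / (4 * Real.pi ^ 2 * Complex.I * t)‖ ^ 2 ≤
      (1 / t) ^ 2 * ((3 * (1616 + 2 ^ δ / δ ^ 2)) * (1 + ‖y‖ ^ 2) ^ δ *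
        (1 + |‖y - x‖ - t| ^ (-1 / 2 : ℝ))) := by
  have hr : 0 < ‖y - x‖ := norm_pos_iff.2 (sub_ne_zero.2 hxy)
  have hη : |(|‖y - x‖ - t|) - (|‖x‖ - t|)| ≤ ‖y‖ := by
    refine (abs_abs_sub_abs_le_abs_sub _ _).trans ?_
    rw [sub_sub_sub_cancel_right, ← norm_neg x]
    refine (abs_norm_sub_norm_le _ _).trans (le_of_eq ?_)
    congr 1
    abel
  have h := norm_kernel_log_le ht hr hε hε1 hεt hq (abs_nonneg _) hη
  rw [fourier_dampedProfile (by simpa using hε) (sub_ne_zero.2 hxy)]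
  set L := Complex.log ((ε - t * Complex.I) + ‖y - x‖ * Complex.I) -
      Complex.log ((ε - t * Complex.I) - ‖y - x‖ * Complex.I)
  set c := Real.log (1 + t / (1 + |‖x‖ - t|))
  have hpi : (Real.pi : ℂ) ≠ 0 := by exact_mod_cast Real.pi_ne_zero
  have htc : (t : ℂ) ≠ 0 := by exact_mod_cast ht.ne'
  have hrc : ((‖y - x‖ : ℝ) : ℂ) ≠ 0 := by exact_mod_cast hr.ne'
  have e : L / (4 * Real.pi ^ 2 * Complex.I * ‖y - x‖) + (c : ℂ) /
      (4 * Real.pi ^ 2 * Complex.I * t) =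
      ((t / ‖y - x‖ : ℂ) * L + (c : ℂ)) / (4 * Real.pi ^ 2 * Complex.I * t) := by
    field_simp [Complex.I_ne_zero]
  have hn : ‖(4 * Real.pi ^ 2 * Complex.I * t : ℂ)‖ = 4 * Real.pi ^ 2 * t := by
    simp [abs_of_pos ht, abs_of_pos Real.pi_pos]
  have hpi2 : 1 * t ≤ 4 * Real.pi ^ 2 * t := by
    gcongr
    nlinarith [Real.pi_gt_three]
  rw [e, norm_div, hn, div_pow, one_div, inv_pow, ← div_eq_inv_mul]
  have h2 := sq_log_add_log_le hδ (norm_nonneg y) (abs_pos.2 (sub_ne_zero.2 hq))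
  rw [one_mul] at hpi2
  gcongr
  exact (pow_le_pow_left₀ (norm_nonneg _) h 2).trans h2

lemma exists_enorm_integral_dampedProfile_le {s : ℝ} (hs : 3 / 2 < s) :
    ∃ K : ℝ≥0∞, K < ⊤ ∧ ∀ g : EuclideanSpace ℝ (Fin 3) → ℂ, Integrable g → ∫ y, g y = 0 →
      ∀ (x : EuclideanSpace ℝ (Fin 3)) (t ε : ℝ), 0 < t → 0 < ε → ε ≤ 1 → ε ≤ t →
        ‖∫ y, 𝓕 (fun ξ : EuclideanSpace ℝ (Fin 3) =>
          dampedProfile (ε - t * Complex.I) ‖ξ‖) (y - x) * g y‖ₑ ≤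
          ENNReal.ofReal (1 / t) * K * eLpNorm (fun y : EuclideanSpace ℝ (Fin 3) =>
            (((1 + ‖y‖ ^ 2) ^ (s / 2) : ℝ)) • g y) 2 volume := by
  obtain ⟨δ, hδ, hδs⟩ : ∃ δ, 0 < δ ∧ 3 / 2 < s - δ :=
    ⟨(s - 3 / 2) / 2, by linarith, by linarith⟩
  obtain ⟨A, hA, hAle⟩ := exists_lintegral_weight_le hδs
  set M : ℝ := 3 * (1616 + 2 ^ δ / δ ^ 2) with hM
  have hM0 : 0 ≤ M := by positivity
  refine ⟨(ENNReal.ofReal M * A) ^ (1 / 2 : ℝ),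
    ENNReal.rpow_lt_top_of_nonneg (by norm_num) (ENNReal.mul_lt_top (by simp) hA).ne,
    fun g hg hg0 x t ε ht hε hε1 hεt => ?_⟩
  set H := 𝓕 (fun ξ : EuclideanSpace ℝ (Fin 3) => dampedProfile (ε - t * Complex.I) ‖ξ‖) with hH
  set c : ℂ := (Real.log (1 + t / (1 + |‖x‖ - t|)) : ℝ) / (4 * Real.pi ^ 2 * Complex.I * t) with hc
  have hdi : Integrable (fun ξ : EuclideanSpace ℝ (Fin 3) =>
      dampedProfile (ε - t * Complex.I) ‖ξ‖) := integrable_dampedProfile (by simpa using hε)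
  have hHc : Continuous H := VectorFourier.fourierIntegral_continuous
    Real.continuous_fourierChar (by exact continuous_inner) hdi
  have h1 : ∫ y, H (y - x) * g y = ∫ y, (H (y - x) + c) * g y := by
    simp_rw [add_mul]
    rw [integral_add (integrable_fourier_sub_mul hdi hg x) (hg.const_mul c), integral_const_mul,
      hg0, mul_zero, add_zero]
  rw [h1]
  refine (enorm_integral_le_lintegral_enorm _).trans ?_
  set w : EuclideanSpace ℝ (Fin 3) → ℝ := fun y => (1 + ‖y‖ ^ 2) ^ (s / 2) with hw
  have hwpos : ∀ y, 0 < w y := fun y => by positivity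
  have hwc : Measurable w := by fun_prop
  set a : EuclideanSpace ℝ (Fin 3) → ℝ≥0∞ := fun y => ‖(w y)⁻¹ • (H (y - x) + c)‖ₑ with ha
  set b : EuclideanSpace ℝ (Fin 3) → ℝ≥0∞ := fun y => ‖w y • g y‖ₑ with hb
  have hab : ∀ y, ‖(H (y - x) + c) * g y‖ₑ = (a * b) y := fun y => by
    simp only [ha, hb, Pi.mul_apply]
    rw [← enorm_mul, smul_mul_smul_comm, inv_mul_cancel₀ (hwpos y).ne', one_smul]
  have ham : AEMeasurable a := by
    have : Measurable fun y => (w y)⁻¹ • (H (y - x) + c) := by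
      have := hHc.measurable
      fun_prop
    exact this.enorm.aemeasurable
  have hbm : AEMeasurable b :=
    (hwc.aestronglyMeasurable.smul hg.aestronglyMeasurable).enorm
  simp_rw [hab]
  refine (ENNReal.lintegral_mul_le_Lp_mul_Lq volume Real.HolderConjugate.two_two ham hbm).trans ?_
  have hb2 : eLpNorm (fun y => w y • g y) 2 volume = (∫⁻ y, b y ^ (2 : ℝ)) ^ (1 / 2 : ℝ) := by
    rw [eLpNorm_eq_lintegral_rpow_enorm_toReal (by simp) (by simp)]
    simp [hb]
  rw [hb2]
  gcongr
  have hpt : ∀ᵐ y, a y ^ (2 : ℝ) ≤ ENNReal.ofReal ((1 / t) ^ 2 * M) *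
      (ENNReal.ofReal ((1 + ‖y‖ ^ 2) ^ (-(s - δ))) *
        (1 + ENNReal.ofReal |‖y - x‖ - t| ^ (-1 / 2 : ℝ))) := by
    have hne : ∀ᵐ y : EuclideanSpace ℝ (Fin 3), y ≠ x := by simp [ae_iff]
    have hsph : ∀ᵐ y : EuclideanSpace ℝ (Fin 3), ‖y - x‖ ≠ t := by
      rw [ae_iff]
      simp only [not_not]
      have := Measure.addHaar_sphere (volume : Measure (EuclideanSpace ℝ (Fin 3))) x t
      simpa [Metric.sphere, dist_eq_norm] using this
    filter_upwards [hne, hsph] with y hy hy2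
    have hk := sq_norm_fourier_dampedProfile_add_le hδ ht hε hε1 hεt hy hy2
    rw [← hH, ← hc, ← hM] at hk
    have hq : 0 < |‖y - x‖ - t| := abs_pos.2 (sub_ne_zero.2 hy2)
    have hw2 : (w y)⁻¹ ^ 2 * (1 + ‖y‖ ^ 2) ^ δ = (1 + ‖y‖ ^ 2) ^ (-(s - δ)) := by
      have hp : 0 < 1 + ‖y‖ ^ 2 := by positivity
      simp only [hw]
      rw [← Real.rpow_neg hp.le, ← Real.rpow_mul_natCast hp.le, ← Real.rpow_add hp]
      congr 1
      push_cast
      ring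
    rw [ENNReal.ofReal_rpow_of_pos hq, ← ENNReal.ofReal_one,
      ← ENNReal.ofReal_add zero_le_one (by positivity), ← ENNReal.ofReal_mul (by positivity),
      ← ENNReal.ofReal_mul (by positivity)]
    simp only [ha]
    rw [← ofReal_norm, ENNReal.ofReal_rpow_of_nonneg (norm_nonneg _) (by norm_num)]
    refine ENNReal.ofReal_le_ofReal ?_
    rw [norm_smul, Real.norm_of_nonneg (inv_nonneg.2 (hwpos y).le), Real.rpow_two, mul_pow, ← hw2]
    calc _ ≤ (w y)⁻¹ ^ 2 * _ := mul_le_mul_of_nonneg_left hk (by positivity)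
      _ = _ := by ring
  calc _ ≤ (ENNReal.ofReal ((1 / t) ^ 2 * M) * A) ^ (1 / 2 : ℝ) := by
        refine ENNReal.rpow_le_rpow ((lintegral_mono_ae hpt).trans ?_) (by norm_num)
        rw [lintegral_const_mul' _ _ (by simp)]
        gcongr
        exact hAle x t ht.le
    _ = _ := by
        rw [ENNReal.ofReal_mul (by positivity), mul_assoc,
          ENNReal.mul_rpow_of_nonneg _ _ (by norm_num : (0 : ℝ) ≤ 1 / 2),
          ENNReal.ofReal_rpow_of_nonneg (by positivity) (by norm_num), ← Real.sqrt_eq_rpow,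
          Real.sqrt_sq (by positivity)]

lemma tendsto_integral_exp_neg_mul_halfWave {F : EuclideanSpace ℝ (Fin 3) → ℂ} (hF : Integrable F)
    (t : ℝ) (x : EuclideanSpace ℝ (Fin 3)) :
    Filter.Tendsto (fun ε : ℝ => ∫ ξ : EuclideanSpace ℝ (Fin 3),
      Complex.exp (2 * Real.pi * Complex.I * ((⟪x, ξ⟫_ℝ : ℝ) : ℂ)) *
        Complex.exp (-(2 * Real.pi * (ε - t * Complex.I)) * ‖ξ‖) * F ξ)
      (nhdsWithin 0 (Set.Ioi 0))
      (nhds (∫ ξ : EuclideanSpace ℝ (Fin 3),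
        Complex.exp (2 * Real.pi * Complex.I * ((⟪x, ξ⟫_ℝ + t * ‖ξ‖ : ℝ) : ℂ)) * F ξ)) := by
  refine tendsto_integral_filter_of_dominated_convergence (fun ξ => ‖F ξ‖) ?_ ?_ hF.norm ?_
  · refine .of_forall fun ε => (Continuous.aestronglyMeasurable ?_).mul hF.aestronglyMeasurable
    fun_prop
  · filter_upwards [self_mem_nhdsWithin] with ε hε
    refine .of_forall fun ξ => ?_
    have hε : 0 < ε := hε
    rw [norm_mul]
    refine mul_le_of_le_one_left (norm_nonneg _) ?_
    rw [← Complex.exp_add, Complex.norm_exp]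
    refine Real.exp_le_one_iff.2 ?_
    have : 0 ≤ 2 * Real.pi * ε * ‖ξ‖ := by positivity
    simpa using this
  · refine .of_forall fun ξ => Filter.Tendsto.mono_left ?_ nhdsWithin_le_nhds
    refine Filter.Tendsto.mul_const _ ?_
    have hcont : Continuous fun ε : ℝ =>
        Complex.exp (2 * Real.pi * Complex.I * ((⟪x, ξ⟫_ℝ : ℝ) : ℂ)) *
        Complex.exp (-(2 * Real.pi * (ε - t * Complex.I)) * ‖ξ‖) := by fun_prop
    convert hcont.tendsto 0 using 2
    rw [← Complex.exp_add]
    congr 1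
    push_cast
    ring

/-- Dispersive estimate with a polynomial weight: for s > 3/2,
‖e^{itΛ}f‖_∞ ≤ (C/t) ‖⟨x⟩ˢ Λ²f‖₂. -/
theorem halfWave_dispersive_weighted_s (s : ℝ) (hs : 3 / 2 < s) :
    ∃ C : ℝ, 0 < C ∧ ∀ (f : SchwartzMap (EuclideanSpace ℝ (Fin 3)) ℂ) (t : ℝ), 0 < t →
      eLpNorm (halfWave t ⇑f) ⊤ volume ≤
        ENNReal.ofReal (C / t) *
          eLpNorm (fun x : EuclideanSpace ℝ (Fin 3) =>
            (((1 + ‖x‖ ^ 2) ^ (s / 2) : ℝ)) • lambdaPow 2 ⇑f x) 2 volume := by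
  obtain ⟨K, hK, hKle⟩ := exists_enorm_integral_dampedProfile_le hs
  refine ⟨K.toReal + 1, by positivity, fun f t ht => ?_⟩
  obtain ⟨g, hlg, hgf⟩ := exists_schwartzMap_lambdaPow_two f
  rw [hlg]
  have hg0 : ∫ y, g y = 0 := by
    have h := hgf 0
    rw [Real.fourier_eq'] at h
    simpa using h
  have hFf : Integrable (𝓕 (⇑f)) := by
    rw [← SchwartzMap.fourier_coe]
    exact (𝓕 f).integrable
  have hpt : ∀ x, ‖halfWave t (⇑f) x‖ₑ ≤ ENNReal.ofReal (1 / t) * K *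
      eLpNorm (fun y : EuclideanSpace ℝ (Fin 3) => (((1 + ‖y‖ ^ 2) ^ (s / 2) : ℝ)) • g y)
        2 volume := by
    intro x
    refine le_of_tendsto (tendsto_integral_exp_neg_mul_halfWave hFf t x).enorm ?_
    have hmem : Set.Ioc 0 (min 1 t) ∈ nhdsWithin (0 : ℝ) (Set.Ioi 0) :=
      Ioc_mem_nhdsGT (by positivity)
    filter_upwards [hmem] with ε hε
    have hdi : Integrable (fun ξ : EuclideanSpace ℝ (Fin 3) =>
        dampedProfile (ε - t * Complex.I) ‖ξ‖) := integrable_dampedProfile (by simpa using hε.1)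
    refine le_trans (le_of_eq ?_) (hKle (⇑g) g.integrable hg0 x t ε ht hε.1
      (hε.2.trans (min_le_left _ _)) (hε.2.trans (min_le_right _ _)))
    rw [← integral_exp_mul_fourier_eq hdi g.integrable x]
    congr 1
    have hne : ∀ᵐ ξ : EuclideanSpace ℝ (Fin 3), ξ ≠ 0 := by simp [ae_iff]
    refine integral_congr_ae ?_
    filter_upwards [hne] with ξ hξ
    have hξc : ((‖ξ‖ : ℝ) : ℂ) ≠ 0 := by exact_mod_cast norm_ne_zero_iff.2 hξ
    have hpi : (Real.pi : ℂ) ≠ 0 := by exact_mod_cast Real.pi_ne_zero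
    rw [hgf, dampedProfile]
    field_simp
  rw [eLpNorm_exponent_top]
  refine essSup_le_of_ae_le _ (.of_forall fun x => (hpt x).trans ?_)
  refine mul_le_mul_left ?_ _
  rw [div_eq_mul_one_div (K.toReal + 1), mul_comm (K.toReal + 1),
    ENNReal.ofReal_mul (by positivity)]
  refine mul_le_mul_right ?_ _
  rw [ENNReal.le_ofReal_iff_toReal_le hK.ne (by positivity)]
  simp
end
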